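/- arXiv:2407.15514 — 2 statements merged into one kernel-verified Lean document; each statement's English description precedes it below -/
import Mathlib

section
/- There exists a function f with f(k) ∈ O(√k) such that every graph G with feedback edge number k has twin-width at most f(k); in fact, every graph with feedback edge number k has twin-width at most √(87k) + o(√k). -/
attribute [local instance] Classical.propDecidable

open Finset

universe u

/-- A trigraph: a finite graph whose edge set is partitioned into black and red edges. -/
structure Trigraph (V : Type u) where
  verts : Finset V
  black : Finset (Sym2 V)
  red : Finset (Sym2 V)
  black_nodiag : ∀ e ∈ black, ¬ e.IsDiag
  red_nodiag : ∀ e ∈ red, ¬ e.IsDiag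
  black_support : ∀ e ∈ black, ∀ x ∈ e, x ∈ verts
  red_support : ∀ e ∈ red, ∀ x ∈ e, x ∈ verts
  disj : Disjoint black red

namespace Trigraph

variable {V : Type u}

def BlackAdj (G : Trigraph V) (x y : V) : Prop := s(x, y) ∈ G.black
def RedAdj (G : Trigraph V) (x y : V) : Prop := s(x, y) ∈ G.red
def Adj (G : Trigraph V) (x y : V) : Prop := G.BlackAdj x y ∨ G.RedAdj x y

noncomputable def redDeg (G : Trigraph V) (x : V) : ℕ := (G.red.filter (fun e => x ∈ e)).card
noncomputable def blackDeg (G : Trigraph V) (x : V) : ℕ := (G.black.filter (fun e => x ∈ e)).card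
noncomputable def deg (G : Trigraph V) (x : V) : ℕ :=
  ((G.black ∪ G.red).filter (fun e => x ∈ e)).card
noncomputable def maxRedDeg (G : Trigraph V) : ℕ := G.verts.sup G.redDeg

/-- The black edges after contracting `v` into `u`. -/
noncomputable def cBlack (G : Trigraph V) (u v : V) : Finset (Sym2 V) :=
  G.black.filter (fun e => u ∉ e ∧ v ∉ e) ∪
    ((G.verts.erase v).filter
      (fun y => y ≠ u ∧ s(u, y) ∈ G.black ∧ s(v, y) ∈ G.black)).image (fun y => s(u, y))

/-- The red edges after contracting `v` into `u`. -/
noncomputable def cRed (G : Trigraph V) (u v : V) : Finset (Sym2 V) :=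
  G.red.filter (fun e => u ∉ e ∧ v ∉ e) ∪
    ((G.verts.erase v).filter
      (fun y => y ≠ u ∧ ¬(s(u, y) ∈ G.black ∧ s(v, y) ∈ G.black) ∧
        (s(u, y) ∈ G.red ∨ s(v, y) ∈ G.red ∨
          ¬((s(u, y) ∈ G.black) ↔ (s(v, y) ∈ G.black))))).image (fun y => s(u, y))

/-- Contraction of the two distinct vertices `u, v` of `G`: `v` is removed, `u` becomes the
new merged vertex; a black edge survives towards a common black neighbor, and a red edge is
created towards any other remaining neighbor of `u` or `v`. If `u = v` or one of them is not a
vertex, `G` is returned unchanged. -/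
noncomputable def contract (G : Trigraph V) (u v : V) : Trigraph V :=
  if h : u ≠ v ∧ u ∈ G.verts ∧ v ∈ G.verts then
    { verts := G.verts.erase v
      black := cBlack G u v
      red := cRed G u v
      black_nodiag := by
        intro e he
        rcases Finset.mem_union.1 he with he | he
        · exact G.black_nodiag e (Finset.mem_filter.1 he).1
        · obtain ⟨y, hy, rfl⟩ := Finset.mem_image.1 he
          have hyu : y ≠ u := ((Finset.mem_filter.1 hy).2).1
          simpa [Sym2.isDiag_iff_proj_eq] using fun hh => hyu (Eq.symm hh)
      red_nodiag := by
        intro e he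
        rcases Finset.mem_union.1 he with he | he
        · exact G.red_nodiag e (Finset.mem_filter.1 he).1
        · obtain ⟨y, hy, rfl⟩ := Finset.mem_image.1 he
          have hyu : y ≠ u := ((Finset.mem_filter.1 hy).2).1
          simpa [Sym2.isDiag_iff_proj_eq] using fun hh => hyu (Eq.symm hh)
      black_support := by
        intro e he x hx
        rcases Finset.mem_union.1 he with he | he
        · rcases Finset.mem_filter.1 he with ⟨heb, hu, hv⟩
          refine Finset.mem_erase.2 ⟨?_, G.black_support e heb x hx⟩
          rintro rfl; exact hv hx
        · obtain ⟨y, hy, rfl⟩ := Finset.mem_image.1 he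
          rcases Sym2.mem_iff.1 hx with rfl | rfl
          · exact Finset.mem_erase.2 ⟨h.1.symm ∘ Eq.symm, h.2.1⟩
          · exact (Finset.mem_filter.1 hy).1
      red_support := by
        intro e he x hx
        rcases Finset.mem_union.1 he with he | he
        · rcases Finset.mem_filter.1 he with ⟨heb, hu, hv⟩
          refine Finset.mem_erase.2 ⟨?_, G.red_support e heb x hx⟩
          rintro rfl; exact hv hx
        · obtain ⟨y, hy, rfl⟩ := Finset.mem_image.1 he
          rcases Sym2.mem_iff.1 hx with rfl | rfl
          · exact Finset.mem_erase.2 ⟨h.1.symm ∘ Eq.symm, h.2.1⟩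
          · exact (Finset.mem_filter.1 hy).1
      disj := by
        rw [Finset.disjoint_left]
        intro e heb her
        rcases Finset.mem_union.1 heb with heb | heb <;>
          rcases Finset.mem_union.1 her with her | her
        · exact Finset.disjoint_left.1 G.disj (Finset.mem_filter.1 heb).1
            (Finset.mem_filter.1 her).1
        · obtain ⟨y, hy, hey⟩ := Finset.mem_image.1 her
          exact ((Finset.mem_filter.1 heb).2).1 (hey ▸ Sym2.mem_mk_left u y)
        · obtain ⟨y, hy, hey⟩ := Finset.mem_image.1 heb
          exact ((Finset.mem_filter.1 her).2).1 (hey ▸ Sym2.mem_mk_left u y)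
        · obtain ⟨y, hy, hey⟩ := Finset.mem_image.1 heb
          obtain ⟨y', hy', hey'⟩ := Finset.mem_image.1 her
          have : y = y' := Sym2.congr_right.1 (hey.trans hey'.symm)
          subst this
          exact (((Finset.mem_filter.1 hy').2).2).1 ((Finset.mem_filter.1 hy).2).2 }
  else G

/-- The trigraph obtained from `G` by performing the contractions recorded in `ps`
(each pair `(u, v)` contracts `v` into `u`). -/
noncomputable def stage (G : Trigraph V) (ps : List (V × V)) : Trigraph V :=
  ps.foldl (fun H p => H.contract p.1 p.2) G

/-- The list `ps` records genuine contractions (distinct current vertices) starting from `G`. -/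
noncomputable def ValidSteps : Trigraph V → List (V × V) → Prop
  | _, [] => True
  | G, p :: ps =>
      p.1 ≠ p.2 ∧ p.1 ∈ G.verts ∧ p.2 ∈ G.verts ∧ ValidSteps (G.contract p.1 p.2) ps

/-- `ps` encodes a (complete) contraction sequence of `G`, ending in a one-vertex trigraph. -/
noncomputable def IsContractionSeq (G : Trigraph V) (ps : List (V × V)) : Prop :=
  ValidSteps G ps ∧ (stage G ps).verts.card = 1

/-- The width of the (partial) contraction sequence of `G` encoded by `ps`: the maximum red
degree appearing in any of its trigraphs. -/
noncomputable def seqWidth (G : Trigraph V) (ps : List (V × V)) : ℕ :=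
  ((List.range (ps.length + 1)).map (fun j => (stage G (ps.take j)).maxRedDeg)).foldr max 0

/-- The twin-width of a trigraph: the minimum width of a contraction sequence. -/
noncomputable def tww (G : Trigraph V) : ℕ :=
  sInf {t | ∃ ps, G.IsContractionSeq ps ∧ G.seqWidth ps ≤ t}

/-- Where the original vertex `x` currently lives after the contractions in `ps`. -/
noncomputable def collapse (ps : List (V × V)) (x : V) : V :=
  ps.foldl (fun y p => if y = p.2 then p.1 else y) x

/-- The bag of a vertex `u` after the contractions in `ps`: all original vertices of `G`
contracted into `u`. -/
noncomputable def bag (G : Trigraph V) (ps : List (V × V)) (u : V) : Finset V :=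
  G.verts.filter (fun x => collapse ps x = u)

/-- The induced subtrigraph on a vertex set `Q`. -/
noncomputable def induce (G : Trigraph V) (Q : Finset V) : Trigraph V where
  verts := G.verts ∩ Q
  black := G.black.filter (fun e => ∀ x ∈ e, x ∈ Q)
  red := G.red.filter (fun e => ∀ x ∈ e, x ∈ Q)
  black_nodiag := fun e he => G.black_nodiag e (Finset.mem_filter.1 he).1
  red_nodiag := fun e he => G.red_nodiag e (Finset.mem_filter.1 he).1
  black_support := fun e he x hx =>
    Finset.mem_inter.2 ⟨G.black_support e (Finset.mem_filter.1 he).1 x hx,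
      (Finset.mem_filter.1 he).2 x hx⟩
  red_support := fun e he x hx =>
    Finset.mem_inter.2 ⟨G.red_support e (Finset.mem_filter.1 he).1 x hx,
      (Finset.mem_filter.1 he).2 x hx⟩
  disj := Finset.disjoint_filter_filter G.disj

/-- The underlying simple graph of a trigraph (ignoring colors). -/
def toSimple (G : Trigraph V) : SimpleGraph V :=
  SimpleGraph.fromEdgeSet ↑(G.black ∪ G.red)

/-- A trigraph is connected if it is nonempty and all pairs of its vertices are joined by paths. -/
def Conn (G : Trigraph V) : Prop :=
  G.verts.Nonempty ∧ ∀ x ∈ G.verts, ∀ y ∈ G.verts, G.toSimple.Reachable x y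

/-- Distance from a vertex `x` to a set `A` of vertices. -/
noncomputable def distToSet (G : Trigraph V) (A : Finset V) (x : V) : ℕ :=
  sInf {d | ∃ a ∈ A, G.toSimple.dist x a = d}

end Trigraph
namespace SimpleGraph

variable {V : Type u} [Fintype V]

/-- The trigraph induced by a simple graph on the vertex set `W`, with all edges black. -/
noncomputable def toTrigraphOn (G : SimpleGraph V) (W : Finset V) : Trigraph V where
  verts := W
  black := (Finset.univ : Finset (Sym2 V)).filter
    (fun e => e ∈ G.edgeSet ∧ ∀ x ∈ e, x ∈ W)
  red := ∅
  black_nodiag := fun e he => G.not_isDiag_of_mem_edgeSet ((Finset.mem_filter.1 he).2).1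
  red_nodiag := by simp
  black_support := fun e he x hx => ((Finset.mem_filter.1 he).2).2 x hx
  red_support := by simp
  disj := Finset.disjoint_empty_right _

/-- The trigraph associated to a simple graph: all vertices, all edges black. -/
noncomputable def toTrigraph (G : SimpleGraph V) : Trigraph V := G.toTrigraphOn Finset.univ

/-- The twin-width of a simple graph. -/
noncomputable def twinWidth (G : SimpleGraph V) : ℕ := G.toTrigraph.tww

/-- The feedback edge number of a simple graph: the minimum number of edges whose deletion
makes the graph acyclic. -/
noncomputable def fedgeNum (G : SimpleGraph V) : ℕ :=
  sInf {k | ∃ F : Finset (Sym2 V), ↑F ⊆ G.edgeSet ∧ F.card = k ∧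
    (G.deleteEdges ↑F).IsAcyclic}

end SimpleGraph

namespace SimpleGraph

/-- In an acyclic graph, every nonempty finite vertex set `S` contains a vertex with at most one
neighbor in `S`. -/
theorem IsAcyclic.exists_mem_forall_adj_eq {V : Type u} {G : SimpleGraph V} (hG : G.IsAcyclic)
    (S : Finset V) (hS : S.Nonempty) :
    ∃ v ∈ S, ∃ q : Option V, ∀ y ∈ S, G.Adj v y → q = some y := by
  have hH : (G.induce (S : Set V)).IsAcyclic := hG.induce _
  have : Nonempty (S : Set V) := hS.to_subtype
  obtain ⟨u, v, p, hp, hmax⟩ := Walk.exists_isPath_forall_isPath_length_le_length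
    (G.induce (S : Set V))
  refine ⟨u, u.2, some p.snd, fun y hy hadj => ?_⟩
  have hadj' : (G.induce (S : Set V)).Adj u ⟨y, hy⟩ := hadj
  have hsupp : (⟨y, hy⟩ : (S : Set V)) ∈ p.support := by
    by_contra hn
    have hcons : (Walk.cons hadj'.symm p).IsPath := hp.cons hn
    have := hmax _ _ _ hcons
    simp at this
  rw [← hH.eq_snd_of_adj_start hp hadj' hsupp]

/-- A finite forest can be rooted: it has a parent function that is increasing for some rank. -/
theorem IsAcyclic.exists_parent {V : Type u} [Fintype V] {G : SimpleGraph V} (hG : G.IsAcyclic) :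
    ∃ (p : V → Option V) (rank : V → ℕ), (∀ x y, p x = some y → rank x < rank y) ∧
      ∀ x y, G.Adj x y → p x = some y ∨ p y = some x := by
  suffices h : ∀ (n : ℕ) (S : Finset V), S.card = n → ∃ (p : V → Option V) (rank : V → ℕ),
      (∀ x y, x ∈ S → p x = some y → y ∈ S ∧ rank x < rank y) ∧
      ∀ x ∈ S, ∀ y ∈ S, G.Adj x y → p x = some y ∨ p y = some x by
    obtain ⟨p, rank, h1, h2⟩ := h _ Finset.univ rfl
    exact ⟨p, rank, fun x y hxy => (h1 x y (Finset.mem_univ _) hxy).2,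
      fun x y => h2 x (Finset.mem_univ _) y (Finset.mem_univ _)⟩
  intro n
  induction n with
  | zero =>
    intro S hS
    rw [Finset.card_eq_zero] at hS
    subst hS
    exact ⟨fun _ => none, fun _ => 0, by simp, by simp⟩
  | succ n ih =>
    intro S hS
    obtain ⟨v, hv, q, hq⟩ := hG.exists_mem_forall_adj_eq S (Finset.card_pos.1 (by omega))
    obtain ⟨p, rank, h1, h2⟩ := ih (S.erase v) (by rw [Finset.card_erase_of_mem hv]; omega)
    refine ⟨fun x => if x = v then (if ∃ y ∈ S, G.Adj v y then q else none) else p x,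
      fun x => if x = v then 0 else rank x + 1, ?_, ?_⟩
    · intro x y hx hxy
      by_cases hxv : x = v
      · subst hxv
        by_cases hy : ∃ y ∈ S, G.Adj x y
        · simp only [if_true, if_pos hy] at hxy
          obtain ⟨z, hz, hadj⟩ := hy
          have := hq z hz hadj
          rw [this] at hxy
          obtain rfl : z = y := by simpa using hxy
          simp [hz, hadj.ne']
        · simp [hy] at hxy
      · simp only [if_neg hxv] at hxy
        obtain ⟨hy, hlt⟩ := h1 x y (Finset.mem_erase.2 ⟨hxv, hx⟩) hxy
        have hyv := (Finset.mem_erase.1 hy).1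
        refine ⟨(Finset.mem_erase.1 hy).2, ?_⟩
        simp only [if_neg hxv, if_neg hyv]
        omega
    · intro x hx y hy hadj
      by_cases hxv : x = v
      · subst hxv
        left
        have : ∃ y ∈ S, G.Adj x y := ⟨y, hy, hadj⟩
        simp [this, hq y hy hadj]
      · by_cases hyv : y = v
        · subst hyv
          right
          have : ∃ z ∈ S, G.Adj y z := ⟨x, hx, hadj.symm⟩
          simp [this, hq x hx hadj.symm]
        · simpa [hxv, hyv] using h2 x (Finset.mem_erase.2 ⟨hxv, hx⟩) y
            (Finset.mem_erase.2 ⟨hyv, hy⟩) hadj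

end SimpleGraph

namespace SimpleGraph

variable {V : Type u} {L : Type*} (G : SimpleGraph V)

/-- All pairs between the parts of `x` and `y` of the partition given by `φ` are adjacent. -/
def Full (φ : V → L) (x y : V) : Prop :=
  ∀ s t, φ s = φ x → φ t = φ y → G.Adj s t

/-- Some pair between the parts of `x` and `y` of the partition given by `φ` is adjacent. -/
def Linked (φ : V → L) (x y : V) : Prop :=
  ∃ s t, φ s = φ x ∧ φ t = φ y ∧ G.Adj s t

/-- The parts of `x` and `y` are distinct, and joined by a red edge in the quotient trigraph. -/
def Mixed (φ : V → L) (x y : V) : Prop :=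
  φ x ≠ φ y ∧ G.Linked φ x y ∧ ¬ G.Full φ x y

/-- The partition obtained by moving everything with label `b` to label `a`. -/
noncomputable def mergeLabel (a b : L) (φ : V → L) : V → L :=
  fun x => if φ x = b then a else φ x

/-- The labels of the parts joined to the part of `x` by a red edge. -/
noncomputable def redLabels [Fintype V] (φ : V → L) (x : V) : Finset L :=
  (Finset.univ.filter (G.Mixed φ x)).image φ

/-- All parts of the partition given by `φ` have red degree at most `w`. -/
def RedBounded [Fintype V] (w : ℕ) (φ : V → L) : Prop :=
  ∀ x, (G.redLabels φ x).card ≤ w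

/-- The partition given by `φ` can be merged step by step to the trivial one, such that all
partitions met after the first one have red degree at most `w`. -/
inductive Mergeable [Fintype V] (w : ℕ) : (V → L) → Prop
  | const (φ : V → L) : (∀ x y, φ x = φ y) → Mergeable w φ
  | step (φ : V → L) (a b : L) : G.RedBounded w (mergeLabel a b φ) →
      Mergeable w (mergeLabel a b φ) → Mergeable w φ

theorem RedBounded.mono [Fintype V] {G : SimpleGraph V} {w w' : ℕ} {φ : V → L}
    (h : G.RedBounded w φ) (hw : w ≤ w') : G.RedBounded w' φ := fun x => (h x).trans hw

/-- Undoing a merge increases red degrees by at most two. -/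
theorem RedBounded.of_mergeLabel [Fintype V] {G : SimpleGraph V} {w : ℕ} {φ : V → L} {a b : L}
    (h : G.RedBounded w (mergeLabel a b φ)) : G.RedBounded (w + 2) φ := by
  intro x
  have hsub : G.redLabels φ x ⊆ G.redLabels (mergeLabel a b φ) x ∪ {a, b} := by
    intro z hz
    obtain ⟨y, hy, rfl⟩ := Finset.mem_image.1 hz
    obtain ⟨hne, ⟨x1, y1, hx1, hy1, hadj⟩, hnf⟩ := (Finset.mem_filter.1 hy).2
    by_cases hab : φ y = a ∨ φ y = b
    · exact Finset.mem_union_right _ (by simpa using hab)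
    push Not at hab
    have hyy : mergeLabel a b φ y = φ y := by simp [mergeLabel, hab.2]
    have hcl : ∀ s t, φ s = φ t → mergeLabel a b φ s = mergeLabel a b φ t := by
      intro s t hst
      simp [mergeLabel, hst]
    refine Finset.mem_union_left _ (Finset.mem_image.2 ⟨y, ?_, hyy⟩)
    refine Finset.mem_filter.2 ⟨Finset.mem_univ _, ?_, ⟨x1, y1, hcl _ _ hx1, hcl _ _ hy1, hadj⟩, ?_⟩
    · rw [hyy]
      unfold mergeLabel
      split_ifs with hb
      · exact hab.1.symm
      · exact hne
    · exact fun hf => hnf fun s t hs ht => hf s t (hcl _ _ hs) (hcl _ _ ht)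
  calc (G.redLabels φ x).card ≤ (G.redLabels (mergeLabel a b φ) x ∪ {a, b}).card :=
        Finset.card_le_card hsub
    _ ≤ (G.redLabels (mergeLabel a b φ) x).card + ({a, b} : Finset L).card :=
        Finset.card_union_le _ _
    _ ≤ w + 2 := Nat.add_le_add (h x) Finset.card_le_two

/-- A partition with at most `w + 1` parts has red degree at most `w`. -/
theorem RedBounded.of_card_image_le [Fintype V] {G : SimpleGraph V} {w : ℕ} {φ : V → L}
    (h : (Finset.univ.image φ).card ≤ w + 1) : G.RedBounded w φ := by
  intro x
  have hsub : G.redLabels φ x ⊆ (Finset.univ.image φ).erase (φ x) := by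
    intro z hz
    obtain ⟨y, hy, rfl⟩ := Finset.mem_image.1 hz
    exact Finset.mem_erase.2 ⟨((Finset.mem_filter.1 hy).2).1.symm,
      Finset.mem_image_of_mem _ (Finset.mem_univ _)⟩
  have h1 := Finset.card_le_card hsub
  rw [Finset.card_erase_of_mem (Finset.mem_image_of_mem _ (Finset.mem_univ _))] at h1
  omega

/-- A partition with at most `w + 1` parts can be merged to the trivial one. -/
theorem Mergeable.of_card_image_le [Fintype V] {G : SimpleGraph V} {w : ℕ} {φ : V → L}
    (h : (Finset.univ.image φ).card ≤ w + 1) : G.Mergeable w φ := by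
  induction hn : (Finset.univ.image φ).card using Nat.strong_induction_on generalizing φ with
  | _ n ih =>
    by_cases hc : ∀ x y, φ x = φ y
    · exact .const φ hc
    push Not at hc
    obtain ⟨x, y, hxy⟩ := hc
    have hsub : Finset.univ.image (mergeLabel (φ x) (φ y) φ) ⊆
        (Finset.univ.image φ).erase (φ y) := by
      intro z hz
      obtain ⟨t, -, rfl⟩ := Finset.mem_image.1 hz
      unfold mergeLabel
      split_ifs with ht
      · simp [hxy]
      · simp [ht]
    have hlt : (Finset.univ.image (mergeLabel (φ x) (φ y) φ)).card < n := by
      have h1 := Finset.card_le_card hsub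
      rw [Finset.card_erase_of_mem (Finset.mem_image_of_mem _ (Finset.mem_univ _))] at h1
      have : 0 < (Finset.univ.image φ).card :=
        Finset.card_pos.2 ⟨_, Finset.mem_image_of_mem _ (Finset.mem_univ x)⟩
      omega
    exact .step φ (φ x) (φ y) (.of_card_image_le (by omega)) (ih _ hlt (by omega) rfl)

end SimpleGraph

namespace Trigraph

variable {V : Type u} {L : Type*} {G : SimpleGraph V}

/-- The trigraph `H` is the quotient of `G` by the partition given by `φ`, on a set of
representatives. -/
structure Represents (G : SimpleGraph V) (H : Trigraph V) (φ : V → L) : Prop where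
  inj : ∀ x ∈ H.verts, ∀ y ∈ H.verts, φ x = φ y → x = y
  surj : ∀ x, ∃ y ∈ H.verts, φ y = φ x
  black : ∀ x ∈ H.verts, ∀ y ∈ H.verts, x ≠ y → (s(x, y) ∈ H.black ↔ G.Full φ x y)
  red : ∀ x ∈ H.verts, ∀ y ∈ H.verts, s(x, y) ∈ H.red ↔ G.Mixed φ x y

theorem Represents.congr {L' : Type*} {H : Trigraph V} {φ : V → L} {ψ : V → L'}
    (h : Represents G H φ) (hψ : ∀ x y, ψ x = ψ y ↔ φ x = φ y) : Represents G H ψ := by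
  obtain ⟨h1, h2, h3, h4⟩ := h
  constructor
  · simpa only [hψ] using h1
  · simpa only [hψ] using h2
  · simpa only [SimpleGraph.Full, hψ] using h3
  · simpa only [SimpleGraph.Full, SimpleGraph.Mixed, SimpleGraph.Linked, Ne, hψ] using h4

theorem Represents.toTrigraph [Fintype V] {φ : V → L} (hφ : Function.Injective φ) :
    Represents G G.toTrigraph φ := by
  constructor
  · exact fun x _ y _ h => hφ h
  · exact fun x => ⟨x, Finset.mem_univ _, rfl⟩
  · intro x _ y _ _
    simp [SimpleGraph.toTrigraph, SimpleGraph.toTrigraphOn, SimpleGraph.Full, hφ.eq_iff]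
  · intro x _ y _
    simp [SimpleGraph.toTrigraph, SimpleGraph.toTrigraphOn, SimpleGraph.Mixed, SimpleGraph.Full,
      SimpleGraph.Linked, hφ.eq_iff]

theorem Represents.maxRedDeg_le [Fintype V] {H : Trigraph V} {φ : V → L} {w : ℕ}
    (h : Represents G H φ) (hw : G.RedBounded w φ) : H.maxRedDeg ≤ w := by
  refine Finset.sup_le fun x hx => le_trans ?_ (hw x)
  have hsub : H.red.filter (fun e => x ∈ e) ⊆
      (H.verts.filter (G.Mixed φ x)).image (fun y => s(x, y)) := by
    intro e he
    obtain ⟨her, hxe⟩ := Finset.mem_filter.1 he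
    obtain ⟨y, rfl⟩ := Sym2.mem_iff_exists.1 hxe
    have hy := H.red_support _ her y (Sym2.mem_mk_right x y)
    exact Finset.mem_image.2 ⟨y, Finset.mem_filter.2 ⟨hy, (h.red x hx y hy).1 her⟩, rfl⟩
  refine (Finset.card_le_card hsub).trans (Finset.card_image_le.trans ?_)
  rw [← Finset.card_image_of_injOn (f := φ)]
  · refine Finset.card_le_card (Finset.image_subset_image fun y hy => ?_)
    exact Finset.mem_filter.2 ⟨Finset.mem_univ _, (Finset.mem_filter.1 hy).2⟩
  · intro a ha b hb hab
    exact h.inj a (Finset.mem_filter.1 ha).1 b (Finset.mem_filter.1 hb).1 hab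

section Contract

variable {H : Trigraph V} {u v : V}

theorem contract_verts (huv : u ≠ v) (hu : u ∈ H.verts) (hv : v ∈ H.verts) :
    (H.contract u v).verts = H.verts.erase v := by
  simp [contract, huv, hu, hv]

theorem contract_black (huv : u ≠ v) (hu : u ∈ H.verts) (hv : v ∈ H.verts) :
    (H.contract u v).black = H.cBlack u v := by
  simp [contract, huv, hu, hv]

theorem contract_red (huv : u ≠ v) (hu : u ∈ H.verts) (hv : v ∈ H.verts) :
    (H.contract u v).red = H.cRed u v := by
  simp [contract, huv, hu, hv]

theorem mem_cBlack_of_ne {x y : V} (hx : x ≠ u) (hx' : x ≠ v) (hy : y ≠ u) (hy' : y ≠ v) :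
    s(x, y) ∈ H.cBlack u v ↔ s(x, y) ∈ H.black := by
  simp only [cBlack, Finset.mem_union, Finset.mem_filter, Finset.mem_image, Sym2.mem_iff,
    Sym2.eq_iff]
  grind

theorem mem_cRed_of_ne {x y : V} (hx : x ≠ u) (hx' : x ≠ v) (hy : y ≠ u) (hy' : y ≠ v) :
    s(x, y) ∈ H.cRed u v ↔ s(x, y) ∈ H.red := by
  simp only [cRed, Finset.mem_union, Finset.mem_filter, Finset.mem_image, Sym2.mem_iff,
    Sym2.eq_iff]
  grind

theorem mem_cBlack_left {y : V} (hy : y ∈ H.verts) (hyu : y ≠ u) (hyv : y ≠ v) :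
    s(u, y) ∈ H.cBlack u v ↔ s(u, y) ∈ H.black ∧ s(v, y) ∈ H.black := by
  simp only [cBlack, Finset.mem_union, Finset.mem_filter, Finset.mem_image, Sym2.mem_iff,
    Finset.mem_erase, Sym2.congr_right]
  grind

theorem mem_cRed_left {y : V} (hy : y ∈ H.verts) (hyu : y ≠ u) (hyv : y ≠ v) :
    s(u, y) ∈ H.cRed u v ↔ ¬ (s(u, y) ∈ H.black ∧ s(v, y) ∈ H.black) ∧
      (s(u, y) ∈ H.red ∨ s(v, y) ∈ H.red ∨ ¬ (s(u, y) ∈ H.black ↔ s(v, y) ∈ H.black)) := by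
  simp only [cRed, Finset.mem_union, Finset.mem_filter, Finset.mem_image, Sym2.mem_iff,
    Finset.mem_erase, Sym2.congr_right]
  grind

theorem _root_.SimpleGraph.full_comm {φ : V → L} {x y : V} : G.Full φ x y ↔ G.Full φ y x :=
  ⟨fun h a b ha hb => (h b a hb ha).symm, fun h a b ha hb => (h b a hb ha).symm⟩

theorem _root_.SimpleGraph.linked_comm {φ : V → L} {x y : V} :
    G.Linked φ x y ↔ G.Linked φ y x :=
  ⟨fun ⟨a, b, ha, hb, h⟩ => ⟨b, a, hb, ha, h.symm⟩, fun ⟨a, b, ha, hb, h⟩ => ⟨b, a, hb, ha, h.symm⟩⟩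

theorem _root_.SimpleGraph.mixed_comm {φ : V → L} {x y : V} : G.Mixed φ x y ↔ G.Mixed φ y x := by
  rw [SimpleGraph.Mixed, SimpleGraph.Mixed, SimpleGraph.full_comm, SimpleGraph.linked_comm, ne_comm]

theorem Represents.contract {φ : V → L} (h : Represents G H φ) (huv : u ≠ v) (hu : u ∈ H.verts)
    (hv : v ∈ H.verts) :
    Represents G (H.contract u v) (SimpleGraph.mergeLabel (φ u) (φ v) φ) := by
  set ψ := SimpleGraph.mergeLabel (φ u) (φ v) φ with hψ
  have hφuv : φ u ≠ φ v := fun hh => huv (h.inj u hu v hv hh)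
  have hne : ∀ x ∈ H.verts, x ≠ u → x ≠ v → φ x ≠ φ u ∧ φ x ≠ φ v := fun x hx h1 h2 =>
    ⟨fun hh => h1 (h.inj x hx u hu hh), fun hh => h2 (h.inj x hx v hv hh)⟩
  have hψu : ψ u = φ u := by simp [hψ, SimpleGraph.mergeLabel, hφuv]
  have hψx : ∀ x ∈ H.verts, x ≠ v → ψ x = φ x := fun x hx h2 => by
    have : φ x ≠ φ v := fun hh => h2 (h.inj x hx v hv hh)
    simp [hψ, SimpleGraph.mergeLabel, this]
  have hcls : ∀ x ∈ H.verts, x ≠ u → x ≠ v → ∀ z, ψ z = ψ x ↔ φ z = φ x := by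
    intro x hx h1 h2 z
    rw [hψx x hx h2]
    have := hne x hx h1 h2
    simp only [hψ, SimpleGraph.mergeLabel]
    split_ifs with hz
    · rw [hz]; exact ⟨fun hh => absurd hh.symm this.1, fun hh => absurd hh.symm this.2⟩
    · rfl
  have hclu : ∀ z, ψ z = ψ u ↔ φ z = φ u ∨ φ z = φ v := by
    intro z
    rw [hψu]
    simp only [hψ, SimpleGraph.mergeLabel]
    split_ifs with hz <;> simp [hz]
  have hfull : ∀ y ∈ H.verts, y ≠ u → y ≠ v →
      (G.Full ψ u y ↔ G.Full φ u y ∧ G.Full φ v y) := by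
    intro y hy h1 h2
    simp only [SimpleGraph.Full, hcls y hy h1 h2, hclu]
    grind
  have hlink : ∀ y ∈ H.verts, y ≠ u → y ≠ v →
      (G.Linked ψ u y ↔ G.Linked φ u y ∨ G.Linked φ v y) := by
    intro y hy h1 h2
    simp only [SimpleGraph.Linked, hcls y hy h1 h2, hclu]
    grind
  have hfl : ∀ x y, G.Full φ x y → G.Linked φ x y := fun x y hf => ⟨x, y, rfl, rfl, hf x y rfl rfl⟩
  have hblack : ∀ y ∈ H.verts, y ≠ u → y ≠ v → (s(u, y) ∈ H.cBlack u v ↔ G.Full ψ u y) := by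
    intro y hy h1 h2
    rw [mem_cBlack_left hy h1 h2, hfull y hy h1 h2, h.black u hu y hy h1.symm,
      h.black v hv y hy h2.symm]
  have hred : ∀ y ∈ H.verts, y ≠ u → y ≠ v → (s(u, y) ∈ H.cRed u v ↔ G.Mixed ψ u y) := by
    intro y hy h1 h2
    have hneq : ψ u ≠ ψ y := fun hh => (hne y hy h1 h2).1 (by
      rw [← hψx y hy h2, ← hh, hψu])
    rw [mem_cRed_left hy h1 h2, SimpleGraph.Mixed, hfull y hy h1 h2, hlink y hy h1 h2,
      h.black u hu y hy h1.symm, h.black v hv y hy h2.symm, h.red u hu y hy, h.red v hv y hy,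
      SimpleGraph.Mixed, SimpleGraph.Mixed]
    have a1 := hfl u y
    have a2 := hfl v y
    have a3 := (hne y hy h1 h2).1.symm
    have a4 := (hne y hy h1 h2).2.symm
    tauto
  constructor
  · rw [contract_verts huv hu hv]
    intro x hx y hy hxy
    obtain ⟨hx1, hx2⟩ := Finset.mem_erase.1 hx
    obtain ⟨hy1, hy2⟩ := Finset.mem_erase.1 hy
    exact h.inj x hx2 y hy2 (by rw [← hψx x hx2 hx1, ← hψx y hy2 hy1, hxy])
  · rw [contract_verts huv hu hv]
    intro x
    obtain ⟨y, hy, hyx⟩ := h.surj x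
    by_cases hyv : y = v
    · refine ⟨u, Finset.mem_erase.2 ⟨huv, hu⟩, Eq.symm ((hclu x).2 (Or.inr ?_))⟩
      rw [← hyx, hyv]
    · refine ⟨y, Finset.mem_erase.2 ⟨hyv, hy⟩, ?_⟩
      simp only [hψ, SimpleGraph.mergeLabel, hyx]
  · rw [contract_verts huv hu hv, contract_black huv hu hv]
    intro x hx y hy hxy
    obtain ⟨hx1, hx2⟩ := Finset.mem_erase.1 hx
    obtain ⟨hy1, hy2⟩ := Finset.mem_erase.1 hy
    by_cases hxu : x = u
    · subst hxu
      exact hblack y hy2 hxy.symm hy1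
    by_cases hyu : y = u
    · subst hyu
      rw [Sym2.eq_swap, SimpleGraph.full_comm]
      exact hblack x hx2 hxy hx1
    rw [mem_cBlack_of_ne hxu hx1 hyu hy1, h.black x hx2 y hy2 hxy]
    simp only [SimpleGraph.Full, hcls x hx2 hxu hx1, hcls y hy2 hyu hy1]
  · rw [contract_verts huv hu hv, contract_red huv hu hv]
    intro x hx y hy
    obtain ⟨hx1, hx2⟩ := Finset.mem_erase.1 hx
    obtain ⟨hy1, hy2⟩ := Finset.mem_erase.1 hy
    by_cases hxy : x = y
    · subst hxy
      refine iff_of_false (fun hh => ?_) (fun hh => hh.1 rfl)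
      rw [← contract_red huv hu hv] at hh
      exact (H.contract u v).red_nodiag _ hh (by simp)
    by_cases hxu : x = u
    · subst hxu
      exact hred y hy2 (Ne.symm hxy) hy1
    by_cases hyu : y = u
    · subst hyu
      rw [Sym2.eq_swap, SimpleGraph.mixed_comm]
      exact hred x hx2 hxy hx1
    rw [mem_cRed_of_ne hxu hx1 hyu hy1, h.red x hx2 y hy2]
    simp only [SimpleGraph.Mixed, SimpleGraph.Linked, SimpleGraph.Full, hcls x hx2 hxu hx1,
      hcls y hy2 hyu hy1, Ne]

end Contract

theorem seqWidth_le_iff {H : Trigraph V} {ps : List (V × V)} {w : ℕ} :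
    H.seqWidth ps ≤ w ↔ ∀ j ≤ ps.length, (stage H (ps.take j)).maxRedDeg ≤ w := by
  have haux : ∀ l : List ℕ, l.foldr max 0 ≤ w ↔ ∀ a ∈ l, a ≤ w := by
    intro l
    induction l with
    | nil => simp
    | cons a l ih => simp [ih]
  rw [seqWidth, haux]
  simp

theorem exists_contractionSeq_of_mergeable [Fintype V] {w : ℕ} {φ : V → L}
    (hφ : G.Mergeable w φ) :
    ∀ H : Trigraph V, Represents G H φ → H.verts.Nonempty → H.maxRedDeg ≤ w →
      ∃ ps, H.IsContractionSeq ps ∧ H.seqWidth ps ≤ w := by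
  induction hφ with
  | const φ hc =>
    intro H hH hne hw
    refine ⟨[], ⟨trivial, ?_⟩, seqWidth_le_iff.2 fun j _ => ?_⟩
    · obtain ⟨x, hx⟩ := hne
      exact Finset.card_eq_one.2 ⟨x, Finset.eq_singleton_iff_unique_mem.2
        ⟨hx, fun y hy => hH.inj y hy x hx (hc y x)⟩⟩
    · simpa [stage] using hw
  | step φ a b hgood _ ih =>
    intro H hH hne hw
    by_cases hb : ∃ y, φ y = b
    · by_cases ha : ∃ x, φ x = a
      · by_cases hab : a = b
        · refine ih H (hH.congr fun x y => ?_) hne hw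
          subst hab
          simp only [SimpleGraph.mergeLabel]
          grind
        obtain ⟨x, rfl⟩ := ha
        obtain ⟨y, rfl⟩ := hb
        obtain ⟨u, hu, hux⟩ := hH.surj x
        obtain ⟨v, hv, hvy⟩ := hH.surj y
        rw [← hux, ← hvy] at ih hgood hab
        have huv : u ≠ v := fun hh => hab (by rw [hh])
        have hrep := hH.contract huv hu hv
        obtain ⟨ps, ⟨hps, hcard⟩, hwid⟩ := ih _ hrep
          ⟨u, by rw [contract_verts huv hu hv]; exact Finset.mem_erase.2 ⟨huv, hu⟩⟩
          (hrep.maxRedDeg_le hgood)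
        refine ⟨(u, v) :: ps, ⟨⟨huv, hu, hv, hps⟩, hcard⟩, seqWidth_le_iff.2 fun j hj => ?_⟩
        cases j with
        | zero => simpa [stage] using hw
        | succ j => exact seqWidth_le_iff.1 hwid j (by simpa using hj)
      · refine ih H (hH.congr fun x y => ?_) hne hw
        have h1 : ∀ x, φ x ≠ a := fun x hx => ha ⟨x, hx⟩
        have := h1 x
        have := h1 y
        simp only [SimpleGraph.mergeLabel]
        grind
    · refine ih H (hH.congr fun x y => ?_) hne hw
      have h1 : ∀ x, φ x ≠ b := fun x hx => hb ⟨x, hx⟩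
      simp [SimpleGraph.mergeLabel, h1]

end Trigraph

/-- The twin-width of `G` is bounded by the red degrees along any sequence of merges that starts
with the discrete partition. -/
theorem SimpleGraph.twinWidth_le_of_mergeable {V : Type u} {L : Type*} [Fintype V]
    {G : SimpleGraph V} {w : ℕ} {φ : V → L} (hφ : Function.Injective φ) (h : G.Mergeable w φ) :
    G.twinWidth ≤ w := by
  unfold twinWidth Trigraph.tww
  rcases isEmpty_or_nonempty V with hV | hV
  · convert Nat.zero_le w
    refine Nat.sInf_eq_zero.2 (Or.inr (Set.eq_empty_iff_forall_notMem.2 ?_))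
    rintro t ⟨ps, ⟨-, hps⟩, -⟩
    obtain ⟨x, -⟩ := Finset.card_eq_one.1 hps
    exact hV.elim x
  · have hrep : Trigraph.Represents G G.toTrigraph φ := .toTrigraph hφ
    refine Nat.sInf_le (Trigraph.exists_contractionSeq_of_mergeable h _ hrep
      (Finset.univ_nonempty (α := V)) ?_)
    refine Finset.sup_le fun x _ => ?_
    simp [Trigraph.redDeg, toTrigraph, toTrigraphOn]

/-- Greedy packing: weights at most `h` can be distributed to consecutively numbered boxes of
capacity `2 * h` such that all boxes but the last one contain at least `h`. -/
theorem Finset.exists_packing {α : Type*} (s : Finset α) (wt : α → ℕ) (h : ℕ)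
    (hwt : ∀ x ∈ s, wt x ≤ h) :
    ∃ (g : α → ℕ) (N : ℕ), (∀ x ∈ s, g x ≤ N) ∧
      (∀ i, ∑ x ∈ s with g x = i, wt x ≤ 2 * h) ∧ N * h ≤ ∑ x ∈ s, wt x := by
  suffices H : ∃ (g : α → ℕ) (N : ℕ), (∀ x ∈ s, g x ≤ N) ∧
      (∀ i, ∑ x ∈ s with g x = i, wt x ≤ 2 * h) ∧
        N * h + ∑ x ∈ s with g x = N, wt x ≤ ∑ x ∈ s, wt x by
    obtain ⟨g, N, h1, h2, h3⟩ := H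
    exact ⟨g, N, h1, h2, by omega⟩
  induction s using Finset.induction_on with
  | empty => exact ⟨fun _ => 0, 0, by simp, by simp, by simp⟩
  | insert a s ha ih =>
    obtain ⟨g, N, h1, h2, h3⟩ := ih fun x hx => hwt x (Finset.mem_insert_of_mem hx)
    have hwa := hwt a (Finset.mem_insert_self a s)
    have key : ∀ M i, ∑ x ∈ insert a s with (Function.update g a M) x = i, wt x =
        (if M = i then wt a else 0) + ∑ x ∈ s with g x = i, wt x := by
      intro M i
      have hs : s.filter (fun x => Function.update g a M x = i) = s.filter (fun x => g x = i) := by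
        refine Finset.filter_congr fun x hx => ?_
        rw [Function.update_of_ne (show x ≠ a by rintro rfl; exact ha hx)]
      rw [Finset.filter_insert, Function.update_self, hs]
      split_ifs with hM
      · rw [Finset.sum_insert (by simp [ha])]
      · simp
    have hmem : ∀ M, N ≤ M → ∀ x ∈ insert a s, Function.update g a M x ≤ M := by
      intro M hM x hx
      by_cases hxa : x = a
      · rw [hxa, Function.update_self]
      · rw [Function.update_of_ne hxa]
        exact (h1 x (Finset.mem_of_mem_insert_of_ne hx hxa)).trans hM
    by_cases hlast : ∑ x ∈ s with g x = N, wt x ≤ h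
    · refine ⟨Function.update g a N, N, hmem N le_rfl, fun i => ?_, ?_⟩
      · rw [key]
        split_ifs with hi
        · subst hi; omega
        · simpa using h2 i
      · rw [key, if_pos rfl, Finset.sum_insert ha]
        omega
    · have hempty : ∑ x ∈ s with g x = N + 1, wt x = 0 := by
        rw [Finset.sum_eq_zero]
        intro x hx
        obtain ⟨hx, hgx⟩ := Finset.mem_filter.1 hx
        have := h1 x hx
        omega
      refine ⟨Function.update g a (N + 1), N + 1, hmem _ (by omega), fun i => ?_, ?_⟩
      · rw [key]
        split_ifs with hi
        · subst hi; omega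
        · simpa using h2 i
      · rw [key, if_pos rfl, Finset.sum_insert ha, hempty, add_one_mul]
        omega

namespace SimpleGraph

/-- A rooted spanning forest of the graph `G` together with a set `core` of vertices that contains
all edges of `G` outside the forest, and an ancestor-closed set `act` of vertices containing the
core such that every vertex outside the core has at most one child in `act`. -/
structure CoreForest {V : Type u} (G : SimpleGraph V) where
  parent : V → Option V
  rank : V → ℕ
  core : Finset V
  act : V → Prop
  rank_lt : ∀ {x y}, parent x = some y → rank x < rank y
  adj : ∀ {x y}, G.Adj x y → parent x = some y ∨ parent y = some x ∨ (x ∈ core ∧ y ∈ core)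
  act_core : ∀ {x}, x ∈ core → act x
  act_parent : ∀ {x y}, parent x = some y → act x → act y
  act_unique : ∀ {x y z}, z ∉ core → parent x = some z → parent y = some z → act x → act y → x = y

namespace CoreForest

variable {V : Type u} {G : SimpleGraph V} (T : G.CoreForest)

/-- `T.Below c x`: the core vertex `c` is a proper descendant of `x`, and no vertex between
`c` and `x` (including `x`) is in the core. -/
inductive Below (c : V) : V → Prop
  | base {x : V} : c ∈ T.core → T.parent c = some x → x ∉ T.core → Below c x
  | step {y x : V} : Below c y → T.parent y = some x → x ∉ T.core → Below c x

/-- `T.Above t x`: the vertex `x` is not in the core, and `t` is its first proper ancestor in the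
core, or `none` if there is no such ancestor. -/
inductive Above (t : Option V) : V → Prop
  | base {x : V} : x ∉ T.core → T.parent x = t → (∀ u, t = some u → u ∈ T.core) → Above t x
  | step {x u : V} : x ∉ T.core → T.parent x = some u → Above t u → Above t x

variable {T}

theorem Below.notMem_core {c x : V} (h : T.Below c x) : x ∉ T.core := by
  cases h <;> assumption

theorem Below.mem_core {c x : V} (h : T.Below c x) : c ∈ T.core := by
  induction h <;> assumption

theorem Below.act {c x : V} (h : T.Below c x) : T.act x := by
  induction h with
  | base hc hp _ => exact T.act_parent hp (T.act_core hc)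
  | step _ hp _ ih => exact T.act_parent hp ih

theorem Below.unique {c c' x : V} (h : T.Below c x) (h' : T.Below c' x) : c = c' := by
  induction h with
  | base hc hp hx =>
    cases h' with
    | base hc' hp' _ => exact T.act_unique hx hp hp' (T.act_core hc) (T.act_core hc')
    | step hb hp' _ =>
      obtain rfl := T.act_unique hx hp hp' (T.act_core hc) hb.act
      exact absurd hc hb.notMem_core
  | step hb hp hx ih =>
    cases h' with
    | base hc' hp' _ =>
      obtain rfl := T.act_unique hx hp hp' hb.act (T.act_core hc')
      exact absurd hc' hb.notMem_core
    | step hb' hp' _ =>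
      obtain rfl := T.act_unique hx hp hp' hb.act hb'.act
      exact ih hb'

theorem Above.notMem_core {t : Option V} {x : V} (h : T.Above t x) : x ∉ T.core := by
  cases h <;> assumption

theorem Above.unique {t t' : Option V} {x : V} (h : T.Above t x) (h' : T.Above t' x) :
    t = t' := by
  induction h with
  | base hx hp ht =>
    cases h' with
    | base _ hp' _ => exact hp.symm.trans hp'
    | step _ hp' hb => exact absurd (ht _ (hp.symm.trans hp')) hb.notMem_core
  | step hx hp hb ih =>
    cases h' with
    | base _ hp' ht' => exact absurd (ht' _ (hp'.symm.trans hp)) hb.notMem_core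
    | step _ hp' hb' =>
      obtain rfl := Option.some.inj (hp.symm.trans hp')
      exact ih hb'

theorem Below.above_parent {c x q : V} {t : Option V} (h : T.Below c x) (ht : T.Above t x)
    (hq : T.parent c = some q) : T.Above t q := by
  induction h with
  | base hc hp hx =>
    obtain rfl := Option.some.inj (hp.symm.trans hq)
    exact ht
  | step hb hp _ ih => exact ih (.step hb.notMem_core hp ht)

theorem Below.exists_parent {c x : V} (h : T.Below c x) : ∃ q, T.parent c = some q := by
  induction h with
  | base _ hp _ => exact ⟨_, hp⟩
  | step _ _ _ ih => exact ih

variable (T)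

/-- The core vertex `c` with `T.Below c x`, if there is one. -/
noncomputable def bot (x : V) : Option V :=
  if h : ∃ c, T.Below c x then some h.choose else none

variable {T}

theorem bot_eq_some {x c : V} : T.bot x = some c ↔ T.Below c x := by
  unfold bot
  split_ifs with h
  · exact ⟨fun hh => Option.some.inj hh ▸ h.choose_spec,
      fun hh => congrArg some (h.choose_spec.unique hh)⟩
  · exact ⟨fun hh => by simp at hh, fun hh => absurd ⟨c, hh⟩ h⟩

variable (T)

/-- A topmost vertex of a component of the forest without the core. -/
def IsTop (r : V) : Prop := r ∉ T.core ∧ ∀ u, T.parent r = some u → u ∈ T.core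

/-- The core vertices attached to the component with topmost vertex `r`. -/
noncomputable def ends (r : V) : Option V × Option V := (T.bot r, T.parent r)

variable [Fintype V]

/-- The pairs of core vertices (or `none`) to which the components outside the core attach. -/
noncomputable def allEnds : Finset (Option V × Option V) :=
  (Finset.univ.filter T.IsTop).image T.ends

theorem card_allEnds_le : T.allEnds.card ≤ 2 * T.core.card + 1 := by
  have h1 : (T.allEnds.filter (fun o => o.1 = none)).card ≤ T.core.card + 1 := by
    have hsub : T.allEnds.filter (fun o => o.1 = none) ⊆
        (insert none (T.core.image some)).image (fun t => ((none : Option V), t)) := by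
      intro o ho
      obtain ⟨ho, hnone⟩ := Finset.mem_filter.1 ho
      obtain ⟨r, hr, rfl⟩ := Finset.mem_image.1 ho
      have hr := (Finset.mem_filter.1 hr).2
      refine Finset.mem_image.2 ⟨T.parent r, ?_, Prod.ext hnone.symm rfl⟩
      cases hp : T.parent r with
      | none => simp
      | some u => simp [hr.2 u hp]
    refine (Finset.card_le_card hsub).trans (Finset.card_image_le.trans ?_)
    exact (Finset.card_insert_le _ _).trans (Nat.add_le_add_right Finset.card_image_le _)
  have h2 : (T.allEnds.filter (fun o => ¬ o.1 = none)).card ≤ T.core.card := by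
    refine le_trans ?_ (Finset.card_image_le (s := T.core) (f := some))
    refine Finset.card_le_card_of_injOn Prod.fst ?_ ?_
    · intro o ho
      obtain ⟨ho, hsome⟩ := Finset.mem_filter.1 ho
      obtain ⟨r, hr, rfl⟩ := Finset.mem_image.1 ho
      obtain ⟨c, hc⟩ := Option.ne_none_iff_exists'.1 hsome
      have hb := bot_eq_some.1 hc
      exact Finset.mem_image.2 ⟨c, hb.mem_core, hc.symm⟩
    · intro o ho o' ho' heq
      obtain ⟨ho, hsome⟩ := Finset.mem_filter.1 ho
      obtain ⟨r, hr, rfl⟩ := Finset.mem_image.1 ho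
      obtain ⟨ho', -⟩ := Finset.mem_filter.1 ho'
      obtain ⟨r', hr', rfl⟩ := Finset.mem_image.1 ho'
      have hr := (Finset.mem_filter.1 hr).2
      have hr' := (Finset.mem_filter.1 hr').2
      obtain ⟨c, hc⟩ := Option.ne_none_iff_exists'.1 hsome
      have hb := bot_eq_some.1 hc
      have hb' := bot_eq_some.1 (heq.symm.trans hc)
      obtain ⟨q, hq⟩ := hb.exists_parent
      have ha := hb.above_parent (.base hr.1 rfl hr.2) hq
      have ha' := hb'.above_parent (.base hr'.1 rfl hr'.2) hq
      exact Prod.ext heq (ha.unique ha')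
  have := Finset.card_filter_add_card_filter_not (s := T.allEnds) (fun o => o.1 = none)
  omega

end CoreForest

end SimpleGraph

namespace SimpleGraph.CoreForest

variable {V : Type u} {G : SimpleGraph V}

/-- The names of the parts of the partitions used to contract a graph with a core forest. -/
inductive Label (V : Type u) : Type u
  | single (v : V)
  | live (v : V)
  | outer (i : ℕ)
  | inner (i : ℕ)

/-- The partition `φ` reached after processing the vertex set `P`: unprocessed vertices form
singletons, processed vertices below an unprocessed vertex `u` in the same component outside the
core are collected in the part `live u`, completely processed components are collected according
to `g₁`, and processed core vertices are collected according to `g₂`. -/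
structure Stage (T : G.CoreForest) (g₁ : Option V × Option V → ℕ) (g₂ : V → ℕ) (light P : Finset V)
    (φ : V → Label V) : Prop where
  closed : ∀ {x y}, T.parent y = some x → x ∈ P → x ∉ T.core → y ∉ T.core → y ∈ P
  single : ∀ {x}, x ∉ P → φ x = .single x
  inner : ∀ {x}, x ∈ P → x ∈ T.core → φ x = .inner (g₂ x)
  inherit : ∀ {x u}, x ∈ P → x ∉ T.core → T.parent x = some u → u ∉ T.core → u ∈ P → φ x = φ u
  live : ∀ {x u}, x ∈ P → x ∉ T.core → T.parent x = some u → u ∉ T.core → u ∉ P → φ x = .live u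
  top : ∀ {x}, x ∈ P → T.IsTop x → φ x = .outer (g₁ (T.ends x))
  light : ∀ {x}, x ∈ P → x ∈ T.core → x ∈ light
  order : ∀ {x y}, x ∈ P → x ∈ T.core → y ∉ T.core → y ∈ P

namespace Stage

variable {T : G.CoreForest} {g₁ : Option V × Option V → ℕ} {g₂ : V → ℕ} {light P : Finset V}
  {φ : V → Label V}

theorem classify [Fintype V] (S : T.Stage g₁ g₂ light P φ) {x : V} (hx : x ∈ P)
    (hxc : x ∉ T.core) :
    (∃ u, u ∉ P ∧ u ∉ T.core ∧ φ x = .live u ∧ ∀ c, T.Below c x → T.Below c u) ∨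
      ∃ r, T.IsTop r ∧ φ x = .outer (g₁ (T.ends r)) ∧ ∀ c, T.Below c x → T.Below c r := by
  induction hn : Finset.univ.sup T.rank - T.rank x using Nat.strong_induction_on
    generalizing x with
  | _ n ih =>
    by_cases htop : T.IsTop x
    · exact .inr ⟨x, htop, S.top hx htop, fun _ h => h⟩
    · obtain ⟨u, hu, huc⟩ : ∃ u, T.parent x = some u ∧ u ∉ T.core := by
        by_contra! h
        exact htop ⟨hxc, h⟩
      by_cases huP : u ∈ P
      · have hlt := T.rank_lt hu
        have hle : T.rank u ≤ Finset.univ.sup T.rank := Finset.le_sup (Finset.mem_univ u)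
        rw [S.inherit hx hxc hu huc huP]
        rcases ih _ (by omega) huP huc rfl with ⟨t, h1, h2, h3, h4⟩ | ⟨r, h1, h2, h3⟩
        · exact .inl ⟨t, h1, h2, h3, fun c hc => h4 c (.step hc hu huc)⟩
        · exact .inr ⟨r, h1, h2, fun c hc => h3 c (.step hc hu huc)⟩
      · exact .inl ⟨u, huP, huc, S.live hx hxc hu huc huP, fun c hc => .step hc hu huc⟩

theorem eq_of_single [Fintype V] (S : T.Stage g₁ g₂ light P φ) {x y : V} (h : φ y = .single x) :
    y ∉ P ∧ y = x := by
  by_cases hy : y ∈ P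
  · by_cases hyc : y ∈ T.core
    · simp [S.inner hy hyc] at h
    · rcases S.classify hy hyc with ⟨u, -, -, h3, -⟩ | ⟨r, -, h2, -⟩
      · simp [h3] at h
      · simp [h2] at h
  · exact ⟨hy, by simpa [S.single hy] using h⟩

theorem of_inner [Fintype V] (S : T.Stage g₁ g₂ light P φ) {i : ℕ} {y : V} (h : φ y = .inner i) :
    y ∈ P ∧ y ∈ T.core ∧ g₂ y = i := by
  by_cases hy : y ∈ P
  · by_cases hyc : y ∈ T.core
    · exact ⟨hy, hyc, by simpa [S.inner hy hyc] using h⟩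
    · rcases S.classify hy hyc with ⟨u, -, -, h3, -⟩ | ⟨r, -, h2, -⟩
      · simp [h3] at h
      · simp [h2] at h
  · simp [S.single hy] at h

theorem mem_of_ne (S : T.Stage g₁ g₂ light P φ) {y : V} (h : ∀ v, φ y ≠ .single v)
    (h' : ∀ i, φ y ≠ .inner i) : y ∈ P ∧ y ∉ T.core := by
  have hy : y ∈ P := by
    by_contra hy
    exact h _ (S.single hy)
  exact ⟨hy, fun hyc => h' _ (S.inner hy hyc)⟩

theorem neighbor [Fintype V] (S : T.Stage g₁ g₂ light P φ) {x y : V} (hx : x ∈ P)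
    (hxc : x ∉ T.core) (hxy : G.Adj x y) :
    φ y = φ x ∨ (∃ u, u ∉ P ∧ u ∉ T.core ∧ φ x = .live u ∧ (y = u ∨ T.Below y u)) ∨
      ∃ r, T.IsTop r ∧ φ x = .outer (g₁ (T.ends r)) ∧
        (T.bot r = some y ∨ T.parent r = some y) := by
  rcases T.adj hxy with hp | hp | hp
  · by_cases hyc : y ∈ T.core
    · have htop : T.IsTop x := ⟨hxc, fun u hu => by rwa [← Option.some.inj (hp.symm.trans hu)]⟩
      exact .inr (.inr ⟨x, htop, S.top hx htop, .inr hp⟩)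
    · by_cases hy : y ∈ P
      · exact .inl (S.inherit hx hxc hp hyc hy).symm
      · exact .inr (.inl ⟨y, hy, hyc, S.live hx hxc hp hyc hy, .inl rfl⟩)
  · by_cases hyc : y ∈ T.core
    · have hb : T.Below y x := .base hyc hp hxc
      rcases S.classify hx hxc with ⟨u, h1, h2, h3, h4⟩ | ⟨r, h1, h2, h3⟩
      · exact .inr (.inl ⟨u, h1, h2, h3, .inr (h4 y hb)⟩)
      · exact .inr (.inr ⟨r, h1, h2, .inl (bot_eq_some.2 (h3 y hb))⟩)
    · exact .inl (S.inherit (S.closed hp hx hxc hyc) hyc hp hxc hx)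
  · exact absurd hp.1 hxc

theorem redBounded [Fintype V] (S : T.Stage g₁ g₂ light P φ) {N₁ N₂ B₁ B₂ w : ℕ}
    (hg₁ : ∀ o ∈ T.allEnds, g₁ o ≤ N₁) (hB₁ : ∀ i, ∑ _o ∈ T.allEnds with g₁ _o = i, 2 ≤ B₁)
    (hg₂ : ∀ c ∈ light, g₂ c ≤ N₂)
    (hB₂ : ∀ i, ∑ c ∈ light with g₂ c = i, (T.core.filter (G.Adj c)).card ≤ B₂)
    (hN : N₁ + N₂ + 3 ≤ w) (hw₁ : B₁ ≤ w) (hw₂ : B₂ + N₁ + 1 ≤ w) : G.RedBounded w φ := by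
  have hends : ∀ {r}, T.IsTop r → T.ends r ∈ T.allEnds := fun hr =>
    Finset.mem_image_of_mem _ (Finset.mem_filter.2 ⟨Finset.mem_univ _, hr⟩)
  have hopt : ∀ o : Option V, o.toFinset.card ≤ 1 := fun o => by cases o <;> simp
  let O : Finset (Label V) := (Finset.range (N₁ + 1)).image .outer
  have hO : O.card ≤ N₁ + 1 := Finset.card_image_le.trans (by simp)
  have houter : ∀ {r}, T.IsTop r → Label.outer (g₁ (T.ends r)) ∈ O := fun hr =>
    Finset.mem_image_of_mem _ (Finset.mem_range.2 (Nat.lt_succ_of_le (hg₁ _ (hends hr))))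
  intro x
  by_cases hx : x ∈ P
  · by_cases hxc : x ∈ T.core
    · let D : Finset V := (light.filter (fun c => g₂ c = g₂ x)).biUnion
        (fun c => T.core.filter (G.Adj c))
      have hsub : G.redLabels φ x ⊆ D.image φ ∪ O := by
        intro z hz
        obtain ⟨y, hy, rfl⟩ := Finset.mem_image.1 hz
        obtain ⟨hne, ⟨x1, y1, hx1, hy1, hadj⟩, -⟩ := (Finset.mem_filter.1 hy).2
        rw [S.inner hx hxc] at hx1
        obtain ⟨hx1P, hx1c, hx1g⟩ := S.of_inner hx1
        rw [← hy1]
        by_cases hyc : y1 ∈ T.core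
        · exact Finset.mem_union_left _ (Finset.mem_image_of_mem _ (Finset.mem_biUnion.2
            ⟨x1, Finset.mem_filter.2 ⟨S.light hx1P hx1c, hx1g⟩, Finset.mem_filter.2 ⟨hyc, hadj⟩⟩))
        · rcases S.neighbor (S.order hx1P hx1c hyc) hyc hadj.symm with
            h | ⟨u, h1, h2, -, -⟩ | ⟨r, h1, h2, -⟩
          · refine absurd ?_ hne
            rw [S.inner hx hxc, ← hx1, h, hy1]
          · exact absurd (S.order hx1P hx1c h2) h1
          · rw [h2]
            exact Finset.mem_union_right _ (houter h1)
      have h1 := (Finset.card_le_card hsub).trans (Finset.card_union_le _ _)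
      have h2 : (D.image φ).card ≤ B₂ :=
        Finset.card_image_le.trans (Finset.card_biUnion_le.trans (hB₂ _))
      omega
    · rcases S.classify hx hxc with ⟨u, -, -, h3, -⟩ | ⟨r, h1, h2, -⟩
      · have hsub : G.redLabels φ x ⊆ {φ u} ∪ (T.bot u).toFinset.image φ := by
          intro z hz
          obtain ⟨y, hy, rfl⟩ := Finset.mem_image.1 hz
          obtain ⟨hne, ⟨x1, y1, hx1, hy1, hadj⟩, -⟩ := (Finset.mem_filter.1 hy).2
          have hx1' := hx1.trans h3
          obtain ⟨hx1P, hx1c⟩ := S.mem_of_ne (y := x1) (by simp [hx1']) (by simp [hx1'])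
          rw [← hy1]
          rcases S.neighbor hx1P hx1c hadj with h | ⟨u', -, -, hu', hb⟩ | ⟨r, -, hr, -⟩
          · exact absurd (by rw [← hx1, ← h, hy1]) hne
          · obtain rfl : u = u' := by simpa [hx1'] using hu'
            rcases hb with rfl | hb
            · exact Finset.mem_union_left _ (Finset.mem_singleton_self _)
            · exact Finset.mem_union_right _ (Finset.mem_image_of_mem _
                (by simp [bot_eq_some.2 hb]))
          · simp [hx1'] at hr
        have h1 := (Finset.card_le_card hsub).trans (Finset.card_union_le _ _)
        have h2 : ((T.bot u).toFinset.image φ).card ≤ 1 := Finset.card_image_le.trans (hopt _)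
        have h4 : ({φ u} : Finset (Label V)).card = 1 := Finset.card_singleton _
        omega
      · let D : Finset V := (T.allEnds.filter (fun o => g₁ o = g₁ (T.ends r))).biUnion
          (fun o => o.1.toFinset ∪ o.2.toFinset)
        have hsub : G.redLabels φ x ⊆ D.image φ := by
          intro z hz
          obtain ⟨y, hy, rfl⟩ := Finset.mem_image.1 hz
          obtain ⟨hne, ⟨x1, y1, hx1, hy1, hadj⟩, -⟩ := (Finset.mem_filter.1 hy).2
          have hx1' := hx1.trans h2
          obtain ⟨hx1P, hx1c⟩ := S.mem_of_ne (y := x1) (by simp [hx1']) (by simp [hx1'])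
          rw [← hy1]
          rcases S.neighbor hx1P hx1c hadj with h | ⟨u', -, -, hu', hb⟩ | ⟨r', h1', hr, hb⟩
          · exact absurd (by rw [← hx1, ← h, hy1]) hne
          · simp [hx1'] at hu'
          · have hgr : g₁ (T.ends r) = g₁ (T.ends r') := by simpa [hx1'] using hr
            refine Finset.mem_image_of_mem _ (Finset.mem_biUnion.2
              ⟨T.ends r', Finset.mem_filter.2 ⟨hends h1', hgr.symm⟩, ?_⟩)
            rcases hb with hb | hb <;> simp [ends, hb]
        have h3 : D.card ≤ B₁ := by
          refine Finset.card_biUnion_le.trans (le_trans (Finset.sum_le_sum fun o _ => ?_) (hB₁ _))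
          have := hopt o.1
          have := hopt o.2
          exact (Finset.card_union_le _ _).trans (by omega)
        exact ((Finset.card_le_card hsub).trans Finset.card_image_le).trans (h3.trans hw₁)
  · obtain ⟨l, hl⟩ : ∃ l, ∀ y, y ∈ P → y ∉ T.core → G.Adj x y → φ y = l ∨ φ y ∈ O := by
      by_cases hxc : x ∈ T.core
      · cases hp : T.parent x with
        | none =>
          refine ⟨.live x, fun y hy hyc hadj => .inr ?_⟩
          rcases T.adj hadj with h | h | h
          · simp [hp] at h
          · have htop : T.IsTop y :=
              ⟨hyc, fun u hu => by rwa [← Option.some.inj (h.symm.trans hu)]⟩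
            rw [S.top hy htop]
            exact houter htop
          · exact absurd h.2 hyc
        | some q =>
          refine ⟨φ q, fun y hy hyc hadj => ?_⟩
          rcases T.adj hadj with h | h | h
          · exact .inl (by rw [Option.some.inj (hp.symm.trans h)])
          · have htop : T.IsTop y :=
              ⟨hyc, fun u hu => by rwa [← Option.some.inj (h.symm.trans hu)]⟩
            rw [S.top hy htop]
            exact .inr (houter htop)
          · exact absurd h.2 hyc
      · refine ⟨.live x, fun y hy hyc hadj => .inl ?_⟩
        rcases T.adj hadj with h | h | h
        · exact absurd (S.closed h hy hyc hxc) hx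
        · exact S.live hy hyc h hxc hx
        · exact absurd h.2 hyc
    let I : Finset (Label V) := (Finset.range (N₂ + 1)).image .inner
    have hI : I.card ≤ N₂ + 1 := Finset.card_image_le.trans (by simp)
    have hsub : G.redLabels φ x ⊆ insert l (O ∪ I) := by
      intro z hz
      obtain ⟨y, hy, rfl⟩ := Finset.mem_image.1 hz
      obtain ⟨hne, ⟨x1, y1, hx1, hy1, hadj⟩, hnf⟩ := (Finset.mem_filter.1 hy).2
      rw [S.single hx] at hx1
      obtain ⟨-, rfl⟩ := S.eq_of_single hx1
      rw [← hy1]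
      by_cases hyP : y1 ∈ P
      · by_cases hyc : y1 ∈ T.core
        · refine Finset.mem_insert_of_mem (Finset.mem_union_right _ ?_)
          rw [S.inner hyP hyc]
          exact Finset.mem_image_of_mem _
            (Finset.mem_range.2 (Nat.lt_succ_of_le (hg₂ _ (S.light hyP hyc))))
        · rcases hl y1 hyP hyc hadj with h | h
          · exact h ▸ Finset.mem_insert_self _ _
          · exact Finset.mem_insert_of_mem (Finset.mem_union_left _ h)
      · refine absurd (fun x' y' hx' hy' => ?_) hnf
        rw [hx1] at hx'
        rw [← hy1, S.single hyP] at hy'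
        rw [(S.eq_of_single hx').2, (S.eq_of_single hy').2]
        exact hadj
    have h1 := Finset.card_le_card hsub
    have h2 := Finset.card_insert_le l (O ∪ I)
    have h3 := Finset.card_union_le O I
    omega

end Stage

end SimpleGraph.CoreForest

namespace SimpleGraph.CoreForest

variable {V : Type u} {G : SimpleGraph V}

namespace Stage

variable {T : G.CoreForest} {g₁ : Option V × Option V → ℕ} {g₂ : V → ℕ} {light P : Finset V}
  {φ : V → Label V}

variable (T g₁) in
/-- The part into which the vertex `v` outside the core is merged. -/
noncomputable def target (v : V) : Label V :=
  if h : ∃ u, T.parent v = some u ∧ u ∉ T.core then .live h.choose else .outer (g₁ (T.ends v))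

theorem target_eq_live {v u : V} (hu : T.parent v = some u) (huc : u ∉ T.core) :
    target T g₁ v = .live u := by
  have h : ∃ u, T.parent v = some u ∧ u ∉ T.core := ⟨u, hu, huc⟩
  rw [target, dif_pos h, Option.some.inj (h.choose_spec.1.symm.trans hu)]

theorem target_eq_outer {v : V} (hv : T.IsTop v) : target T g₁ v = .outer (g₁ (T.ends v)) :=
  dif_neg fun ⟨u, hu, huc⟩ => huc (hv.2 u hu)

theorem merge_notMem_core (S : T.Stage g₁ g₂ light P φ) {v : V} (hv : v ∉ P) (hvc : v ∉ T.core)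
    (hmin : ∀ y, y ∉ P → y ∉ T.core → T.rank v ≤ T.rank y) :
    T.Stage g₁ g₂ light (insert v P)
      (mergeLabel (target T g₁ v) (.live v) (mergeLabel (target T g₁ v) (.single v) φ)) := by
  set ψ := mergeLabel (target T g₁ v) (.live v) (mergeLabel (target T g₁ v) (.single v) φ) with hψ
  have hcongr : ∀ {x y}, φ x = φ y → ψ x = ψ y := fun h => congrArg
    (mergeLabel (target T g₁ v) (.live v) (mergeLabel (target T g₁ v) (.single v) id)) h
  have hkeep : ∀ {x}, φ x ≠ .single v → φ x ≠ .live v → ψ x = φ x := fun h h' => by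
    simp [hψ, mergeLabel, h, h']
  have hsingle : ∀ {x}, φ x = .single v → ψ x = target T g₁ v := fun h => by
    simp [hψ, mergeLabel, h]
  have hlive : ∀ {x}, φ x = .live v → ψ x = target T g₁ v := fun h => by
    simp [hψ, mergeLabel, h]
  have hparent : ∀ {u}, T.parent v = some u → u ∉ T.core → u ∉ insert v P := by
    intro u hu huc hmem
    rcases Finset.mem_insert.1 hmem with rfl | hmem
    · exact (T.rank_lt hu).false
    · exact hv (S.closed hu hmem huc hvc)
  constructor
  · intro x y hp hx hxc hyc
    rcases Finset.mem_insert.1 hx with rfl | hx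
    · by_contra hy
      have := hmin y (fun h => hy (Finset.mem_insert_of_mem h)) hyc
      have := T.rank_lt hp
      omega
    · exact Finset.mem_insert_of_mem (S.closed hp hx hxc hyc)
  · intro x hx
    rw [Finset.mem_insert, not_or] at hx
    have h := S.single hx.2
    rw [hkeep (by simpa [h] using hx.1) (by simp [h]), h]
  · intro x hx hxc
    rcases Finset.mem_insert.1 hx with rfl | hx
    · exact absurd hxc hvc
    · have h := S.inner hx hxc
      rw [hkeep (by simp [h]) (by simp [h]), h]
  · intro x u hx hxc hp huc hu
    rcases Finset.mem_insert.1 hx with rfl | hx'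
    · exact absurd hu (hparent hp huc)
    · rcases Finset.mem_insert.1 hu with rfl | hu
      · rw [hlive (S.live hx' hxc hp huc hv), hsingle (S.single hv)]
      · exact hcongr (S.inherit hx' hxc hp huc hu)
  · intro x u hx hxc hp huc hu
    rcases Finset.mem_insert.1 hx with rfl | hx
    · rw [hsingle (S.single hv), target_eq_live hp huc]
    · rw [Finset.mem_insert, not_or] at hu
      have h := S.live hx hxc hp huc hu.2
      rw [hkeep (by simp [h]) (by simpa [h] using hu.1), h]
  · intro x hx htop
    rcases Finset.mem_insert.1 hx with rfl | hx
    · rw [hsingle (S.single hv), target_eq_outer htop]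
    · have h := S.top hx htop
      rw [hkeep (by simp [h]) (by simp [h]), h]
  · intro x hx hxc
    rcases Finset.mem_insert.1 hx with rfl | hx
    · exact absurd hxc hvc
    · exact S.light hx hxc
  · intro x y hx hxc hyc
    rcases Finset.mem_insert.1 hx with rfl | hx
    · exact absurd hxc hvc
    · exact Finset.mem_insert_of_mem (S.order hx hxc hyc)

theorem merge_mem_core (S : T.Stage g₁ g₂ light P φ) {c : V} (hc : c ∉ P) (hcc : c ∈ T.core)
    (hcl : c ∈ light) (hall : ∀ y, y ∉ T.core → y ∈ P) :
    T.Stage g₁ g₂ light (insert c P) (mergeLabel (.inner (g₂ c)) (.single c) φ) := by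
  set ψ := mergeLabel (.inner (g₂ c)) (.single c) φ with hψ
  have hcongr : ∀ {x y}, φ x = φ y → ψ x = ψ y := fun h => by simp [hψ, mergeLabel, h]
  have hkeep : ∀ {x}, φ x ≠ .single c → ψ x = φ x := fun h => by simp [hψ, mergeLabel, h]
  have hsingle : ∀ {x}, φ x = .single c → ψ x = .inner (g₂ c) := fun h => by
    simp [hψ, mergeLabel, h]
  have hmem : ∀ {x}, x ∉ T.core → x ∈ P := fun h => hall _ h
  constructor
  · exact fun _ _ _ hyc => Finset.mem_insert_of_mem (hmem hyc)
  · intro x hx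
    rw [Finset.mem_insert, not_or] at hx
    have h := S.single hx.2
    rw [hkeep (by simpa [h] using hx.1), h]
  · intro x hx hxc
    rcases Finset.mem_insert.1 hx with rfl | hx
    · exact hsingle (S.single hc)
    · have h := S.inner hx hxc
      rw [hkeep (by simp [h]), h]
  · exact fun _ hxc hp huc _ => hcongr (S.inherit (hmem hxc) hxc hp huc (hmem huc))
  · exact fun _ _ _ huc hu => absurd (Finset.mem_insert_of_mem (hmem huc)) hu
  · intro x _ htop
    have h := S.top (hmem htop.1) htop
    rw [hkeep (by simp [h]), h]
  · intro x hx hxc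
    rcases Finset.mem_insert.1 hx with rfl | hx
    · exact hcl
    · exact S.light hx hxc
  · exact fun _ _ hyc => Finset.mem_insert_of_mem (hmem hyc)

theorem mergeable [Fintype V] (S : T.Stage g₁ g₂ light P φ) {N₁ N₂ B₁ B₂ w : ℕ}
    (hg₁ : ∀ o ∈ T.allEnds, g₁ o ≤ N₁) (hB₁ : ∀ i, ∑ _o ∈ T.allEnds with g₁ _o = i, 2 ≤ B₁)
    (hg₂ : ∀ c ∈ light, g₂ c ≤ N₂)
    (hB₂ : ∀ i, ∑ c ∈ light with g₂ c = i, (T.core.filter (G.Adj c)).card ≤ B₂)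
    (hN : N₁ + N₂ + (T.core \ light).card + 3 ≤ w) (hw₁ : B₁ ≤ w) (hw₂ : B₂ + N₁ + 1 ≤ w) :
    G.Mergeable (w + 2) φ := by
  have hred : ∀ {P φ}, T.Stage g₁ g₂ light P φ → G.RedBounded w φ := fun S' =>
    S'.redBounded hg₁ hB₁ hg₂ hB₂ (by omega) hw₁ hw₂
  induction hn : (Finset.univ \ P).card using Nat.strong_induction_on generalizing P φ with
  | _ n ih =>
    have hlt : ∀ {v}, v ∉ P → (Finset.univ \ insert v P).card < n := by
      intro v hv
      rw [← hn]
      refine Finset.card_lt_card (Finset.ssubset_iff.2 ⟨v, by simp, ?_⟩)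
      intro x hx
      rcases Finset.mem_insert.1 hx with rfl | hx
      · simpa using hv
      · simp only [Finset.mem_sdiff, Finset.mem_univ, Finset.mem_insert, not_or, true_and] at hx ⊢
        exact hx.2
    by_cases h1 : ∃ v, v ∉ P ∧ v ∉ T.core
    · obtain ⟨v, hv, hmin⟩ := Finset.exists_min_image
        (Finset.univ.filter fun v => v ∉ P ∧ v ∉ T.core) T.rank (by simpa [Finset.Nonempty] using h1)
      simp only [Finset.mem_filter, Finset.mem_univ, true_and] at hv hmin
      have S' := S.merge_notMem_core hv.1 hv.2 fun y hy hyc => hmin y ⟨hy, hyc⟩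
      have hb := hred S'
      exact .step _ _ _ hb.of_mergeLabel
        (.step _ _ _ (hb.mono (by omega)) (ih _ (hlt hv.1) S' rfl))
    · push Not at h1
      have hall : ∀ y, y ∉ T.core → y ∈ P := fun y hyc => by
        by_contra hy
        exact hyc (h1 y hy)
      by_cases h2 : ∃ c, c ∉ P ∧ c ∈ light
      · obtain ⟨c, hc, hcl⟩ := h2
        have S' := S.merge_mem_core hc (h1 c hc) hcl hall
        exact .step _ _ _ ((hred S').mono (by omega)) (ih _ (hlt hc) S' rfl)
      · push Not at h2
        have hsub : Finset.univ.image φ ⊆ (Finset.range (N₁ + 1)).image .outer ∪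
            (Finset.range (N₂ + 1)).image .inner ∪ (T.core \ light).image .single := by
          intro z hz
          obtain ⟨x, -, rfl⟩ := Finset.mem_image.1 hz
          by_cases hx : x ∈ P
          · refine Finset.mem_union_left _ ?_
            by_cases hxc : x ∈ T.core
            · rw [S.inner hx hxc]
              exact Finset.mem_union_right _ (Finset.mem_image_of_mem _
                (Finset.mem_range.2 (Nat.lt_succ_of_le (hg₂ _ (S.light hx hxc)))))
            · rcases S.classify hx hxc with ⟨u, hu, huc, -, -⟩ | ⟨r, hr, h, -⟩
              · exact absurd (hall u huc) hu
              · rw [h]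
                exact Finset.mem_union_left _ (Finset.mem_image_of_mem _
                  (Finset.mem_range.2 (Nat.lt_succ_of_le (hg₁ _ (Finset.mem_image_of_mem _
                    (Finset.mem_filter.2 ⟨Finset.mem_univ _, hr⟩))))))
          · rw [S.single hx]
            exact Finset.mem_union_right _ (Finset.mem_image_of_mem _
              (Finset.mem_sdiff.2 ⟨h1 x hx, h2 x hx⟩))
        apply Mergeable.of_card_image_le
        have c1 := Finset.card_le_card hsub
        have c2 := Finset.card_union_le ((Finset.range (N₁ + 1)).image .outer ∪
            (Finset.range (N₂ + 1)).image .inner) ((T.core \ light).image (Label.single (V := V)))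
        have c3 := Finset.card_union_le ((Finset.range (N₁ + 1)).image (Label.outer (V := V)))
          ((Finset.range (N₂ + 1)).image .inner)
        have c4 : ((Finset.range (N₁ + 1)).image (Label.outer (V := V))).card ≤ N₁ + 1 :=
          Finset.card_image_le.trans (by simp)
        have c5 : ((Finset.range (N₂ + 1)).image (Label.inner (V := V))).card ≤ N₂ + 1 :=
          Finset.card_image_le.trans (by simp)
        have c6 : ((T.core \ light).image (Label.single (V := V))).card ≤ (T.core \ light).card :=
          Finset.card_image_le
        omega

end Stage

theorem stage_single (T : G.CoreForest) (g₁ : Option V × Option V → ℕ) (g₂ : V → ℕ)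
    (light : Finset V) : T.Stage g₁ g₂ light ∅ .single := by
  constructor <;> simp

/-- Numerical bound on the twin-width of a graph with a core forest. -/
theorem twinWidth_le [Fintype V] (T : G.CoreForest) {k r : ℕ} (hr : k < r ^ 2)
    (hcore : T.core.card ≤ 4 * k)
    (hdeg : ∑ c ∈ T.core, (T.core.filter (G.Adj c)).card ≤ 10 * k) :
    G.twinWidth ≤ 9 * r + 3 := by
  have hr0 : 0 < r := by
    rcases Nat.eq_zero_or_pos r with rfl | h
    · simp at hr
    · exact h
  let d : V → ℕ := fun c => (T.core.filter (G.Adj c)).card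
  obtain ⟨g₁, N₁, hg₁, hB₁, hN₁⟩ := Finset.exists_packing T.allEnds (fun _ => 2) (4 * r)
    (fun _ _ => by omega)
  obtain ⟨g₂, N₂, hg₂, hB₂, hN₂⟩ := Finset.exists_packing (T.core.filter fun c => d c ≤ 2 * r) d
    (2 * r) (fun c hc => (Finset.mem_filter.1 hc).2)
  have hH : (T.core \ T.core.filter fun c => d c ≤ 2 * r).card * (2 * r) ≤
      ∑ c ∈ T.core \ T.core.filter (fun c => d c ≤ 2 * r), d c := by
    rw [← smul_eq_mul]
    refine Finset.card_nsmul_le_sum _ _ _ fun c hc => ?_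
    simp only [Finset.mem_sdiff, Finset.mem_filter, not_and, not_le] at hc
    exact (hc.2 hc.1).le
  have hsum := Finset.sum_sdiff (f := d)
    (Finset.filter_subset (fun c => d c ≤ 2 * r) T.core)
  have hN₁' : N₁ < 4 * r := by
    have h1 := T.card_allEnds_le
    rw [Finset.sum_const, smul_eq_mul] at hN₁
    by_contra! h
    nlinarith
  set H := (T.core \ T.core.filter fun c => d c ≤ 2 * r).card
  have hdeg' : ∑ c ∈ T.core, d c ≤ 10 * k := hdeg
  have hN₂' : N₂ + H < 5 * r := by
    by_contra! h
    nlinarith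
  refine twinWidth_le_of_mergeable (φ := Label.single) (fun x y h => by simpa using h) ?_
  exact (T.stage_single g₁ g₂ (T.core.filter fun c => d c ≤ 2 * r)).mergeable
    (w := 9 * r + 1) hg₁ hB₁ hg₂ hB₂ (by omega) (by omega) (by omega)

end SimpleGraph.CoreForest

/-- The fibers of a partial function over its values are disjoint. -/
theorem Finset.sum_card_filter_eq_some_le {V : Type*} [Fintype V] (s : Finset V)
    (p : V → Option V) : ∑ z, (s.filter fun x => p x = some z).card ≤ s.card := by
  rw [Finset.card_eq_sum_card_fiberwise (f := p) (t := Finset.univ) (fun _ _ => Finset.mem_univ _),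
    Fintype.sum_option]
  exact Nat.le_add_left _ _

theorem Sym2.card_filter_mem_le {V : Type*} [Fintype V] (e : Sym2 V) :
    (Finset.univ.filter fun x => x ∈ e).card ≤ 2 := by
  induction e using Sym2.ind with
  | _ a b =>
    refine le_trans (Finset.card_le_card ?_) (Finset.card_le_two (a := a) (b := b))
    intro x hx
    simpa using hx

namespace SimpleGraph

variable {V : Type u} [Fintype V]

/-- If deleting `k` edges from `G` leaves a forest, then `G` has a core forest with a core of size
at most `4 * k` that spans few edges. -/
theorem IsAcyclic.exists_coreForest {G : SimpleGraph V} {F : Finset (Sym2 V)}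
    (hF : (G.deleteEdges ↑F).IsAcyclic) :
    ∃ T : G.CoreForest, T.core.card ≤ 4 * F.card ∧
      ∑ c ∈ T.core, (T.core.filter (G.Adj c)).card ≤ 10 * F.card := by
  obtain ⟨p, rank, hrank, hadj⟩ := hF.exists_parent
  have hadj' : ∀ x y, G.Adj x y → p x = some y ∨ p y = some x ∨ s(x, y) ∈ F := by
    intro x y hxy
    by_cases he : s(x, y) ∈ F
    · exact .inr (.inr he)
    · rcases hadj x y (by simpa [deleteEdges_adj] using ⟨hxy, he⟩) with h | h
      · exact .inl h
      · exact .inr (.inl h)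
  let M : Finset V := Finset.univ.filter fun x => ∃ e ∈ F, x ∈ e
  let act : V → Prop := fun x => ∃ m ∈ M, Relation.ReflTransGen (fun a b => p a = some b) m x
  have hact : ∀ {x y}, p x = some y → act x → act y := fun h ⟨m, hm, hmx⟩ => ⟨m, hm, hmx.tail h⟩
  let children : V → Finset V := fun z => (Finset.univ.filter act).filter fun x => p x = some z
  let B : Finset V := Finset.univ.filter fun z => 1 < (children z).card
  have hM : M.card ≤ 2 * F.card := by
    have hsub : M ⊆ F.biUnion fun e => Finset.univ.filter fun x => x ∈ e := by
      intro x hx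
      simpa [M] using hx
    rw [mul_comm]
    exact (Finset.card_le_card hsub).trans
      (Finset.card_biUnion_le_card_mul _ _ _ fun e _ => e.card_filter_mem_le)
  have hB : B.card ≤ M.card := by
    have hchild : ∑ z, (children z).card ≤ (Finset.univ.filter act).card :=
      Finset.sum_card_filter_eq_some_le _ p
    have hpt : ∑ z, ((if act z then 1 else 0) + if 1 < (children z).card then 1 else 0) ≤
        ∑ z, ((children z).card + if z ∈ M then 1 else 0) := by
      refine Finset.sum_le_sum fun z _ => ?_
      by_cases hz : act z
      · have hone : z ∈ M ∨ 0 < (children z).card := by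
          obtain ⟨m, hm, hmz⟩ := hz
          rcases hmz.cases_tail with rfl | ⟨x, hmx, hx⟩
          · exact .inl hm
          · exact .inr (Finset.card_pos.2 ⟨x, by simpa [children, hx] using ⟨m, hm, hmx⟩⟩)
        rw [if_pos hz]
        split_ifs <;> grind
      · have hzero : (children z).card = 0 := by
          refine Finset.card_eq_zero.2 (Finset.eq_empty_of_forall_notMem fun x hx => hz ?_)
          simp only [children, Finset.mem_filter, Finset.mem_univ, true_and] at hx
          exact hact hx.2 hx.1
        simp [hz, hzero]
    rw [Finset.sum_add_distrib, Finset.sum_add_distrib, ← Finset.card_filter, ← Finset.card_filter,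
      ← Finset.card_filter, Finset.filter_mem_eq_inter, Finset.univ_inter] at hpt
    change (Finset.univ.filter act).card + B.card ≤ _ at hpt
    omega
  have hcard : (M ∪ B).card ≤ 4 * F.card := (Finset.card_union_le _ _).trans (by omega)
  refine ⟨⟨p, rank, M ∪ B, act, fun h => hrank _ _ h, ?_, ?_, hact, ?_⟩, hcard, ?_⟩
  · intro x y hxy
    rcases hadj' x y hxy with h | h | h
    · exact .inl h
    · exact .inr (.inl h)
    · refine .inr (.inr ⟨Finset.mem_union_left _ ?_, Finset.mem_union_left _ ?_⟩)
      · exact Finset.mem_filter.2 ⟨Finset.mem_univ _, _, h, Sym2.mem_mk_left _ _⟩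
      · exact Finset.mem_filter.2 ⟨Finset.mem_univ _, _, h, Sym2.mem_mk_right _ _⟩
  · intro x hx
    rcases Finset.mem_union.1 hx with hx | hx
    · exact ⟨x, hx, .refl⟩
    · have hpos : 0 < (children x).card := zero_lt_one.trans (Finset.mem_filter.1 hx).2
      obtain ⟨y, hy⟩ := Finset.card_pos.1 hpos
      simp only [children, Finset.mem_filter, Finset.mem_univ, true_and] at hy
      exact hact hy.2 hy.1
  · intro x y z hz hxz hyz hx hy
    have hle : (children z).card ≤ 1 := by
      by_contra! h
      exact hz (Finset.mem_union_right _ (Finset.mem_filter.2 ⟨Finset.mem_univ _, h⟩))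
    exact Finset.card_le_one.1 hle x (by simpa [children, hxz] using hx) y
      (by simpa [children, hyz] using hy)
  · set C := M ∪ B
    have hpt : ∀ c ∈ C, (C.filter (G.Adj c)).card ≤ 1 + (C.filter fun x => p x = some c).card +
        (F.filter fun e => c ∈ e).card := by
      intro c _
      have hsub : C.filter (G.Adj c) ⊆ (p c).toFinset ∪ (C.filter fun x => p x = some c) ∪
          C.filter fun y => s(c, y) ∈ F := by
        intro y hy
        obtain ⟨hy, hcy⟩ := Finset.mem_filter.1 hy
        rcases hadj' c y hcy with h | h | h <;> simp [h, hy]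
      have h1 : (p c).toFinset.card ≤ 1 := by cases p c <;> simp
      have h2 : (C.filter fun y => s(c, y) ∈ F).card ≤ (F.filter fun e => c ∈ e).card := by
        refine Finset.card_le_card_of_injOn (fun y => s(c, y)) ?_ ?_
        · intro y hy
          simpa using (Finset.mem_filter.1 hy).2
        · exact fun y _ y' _ h => Sym2.congr_right.1 h
      have h3 := Finset.card_le_card hsub
      have h4 := Finset.card_union_le ((p c).toFinset ∪ C.filter fun x => p x = some c)
        (C.filter fun y => s(c, y) ∈ F)
      have h5 := Finset.card_union_le (p c).toFinset (C.filter fun x => p x = some c)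
      omega
    have hsum := Finset.sum_le_sum hpt
    rw [Finset.sum_add_distrib, Finset.sum_add_distrib, Finset.sum_const, smul_eq_mul,
      mul_one] at hsum
    have h1 : ∑ c ∈ C, (C.filter fun x => p x = some c).card ≤ C.card :=
      (Finset.sum_le_univ_sum_of_nonneg fun _ => Nat.zero_le _).trans
        (Finset.sum_card_filter_eq_some_le C p)
    have h2 : ∑ c ∈ C, (F.filter fun e => c ∈ e).card ≤ 2 * F.card := by
      have hcomm := Finset.sum_card_bipartiteAbove_eq_sum_card_bipartiteBelow
        (s := C) (t := F) (fun c e => c ∈ e)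
      simp only [Finset.bipartiteAbove, Finset.bipartiteBelow] at hcomm
      rw [hcomm, mul_comm]
      refine Finset.sum_le_card_nsmul _ _ _ fun e _ => ?_
      exact (Finset.card_le_card (Finset.filter_subset_filter _ (Finset.subset_univ _))).trans
        e.card_filter_mem_le
    exact hsum.trans (by omega)

theorem twinWidth_le_nine_mul_sqrt (G : SimpleGraph V) :
    (G.twinWidth : ℝ) ≤ 9 * Real.sqrt G.fedgeNum + 12 := by
  have hne : {k | ∃ F : Finset (Sym2 V), ↑F ⊆ G.edgeSet ∧ F.card = k ∧
      (G.deleteEdges ↑F).IsAcyclic}.Nonempty := by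
    refine ⟨_, Finset.univ.filter fun e => e ∈ G.edgeSet, by simp, rfl, ?_⟩
    have : G.deleteEdges ↑(Finset.univ.filter fun e => e ∈ G.edgeSet) = ⊥ := by
      ext x y
      simp
    rw [this]
    exact isAcyclic_bot
  obtain ⟨F, -, hcard, hF⟩ := Nat.sInf_mem hne
  change F.card = G.fedgeNum at hcard
  obtain ⟨T, hcore, hdeg⟩ := hF.exists_coreForest
  have h := T.twinWidth_le (k := F.card) (r := Nat.sqrt F.card + 1)
    (by simpa [sq] using Nat.lt_succ_sqrt F.card) hcore hdeg
  have h1 : (G.twinWidth : ℝ) ≤ ((9 * (Nat.sqrt F.card + 1) + 3 : ℕ) : ℝ) := by exact_mod_cast h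
  have h2 := Real.nat_sqrt_le_real_sqrt (a := F.card)
  rw [← hcard]
  push_cast at h1
  linarith

end SimpleGraph

open Asymptotics Filter

/-- **Twin-width is `O(√k)` in the feedback edge number `k`.**
There is a function `f(k) ∈ O(√k)` bounding the twin-width of every graph with feedback edge
number `k`; in fact every graph with feedback edge number `k` has twin-width at most
`√(87 k) + o(√k)`. -/
theorem twinWidth_le_sqrt_fedgeNum :
    ∃ f : ℕ → ℝ,
      (f =O[atTop] fun k : ℕ => Real.sqrt k) ∧
      (∀ (V : Type) [Fintype V] (G : SimpleGraph V),
        (G.twinWidth : ℝ) ≤ f G.fedgeNum) ∧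
      ∃ g : ℕ → ℝ,
        (g =o[atTop] fun k : ℕ => Real.sqrt k) ∧
        ∀ (V : Type) [Fintype V] (G : SimpleGraph V),
          (G.twinWidth : ℝ) ≤ Real.sqrt (87 * G.fedgeNum) + g G.fedgeNum := by
  have hsqrt : Tendsto (fun k : ℕ => Real.sqrt k) atTop atTop :=
    Real.tendsto_sqrt_atTop.comp tendsto_natCast_atTop_atTop
  have hconst : (fun _ : ℕ => (12 : ℝ)) =o[atTop] fun k : ℕ => Real.sqrt k :=
    isLittleO_const_left.2 (.inr (tendsto_norm_atTop_atTop.comp hsqrt))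
  refine ⟨fun k => 9 * Real.sqrt k + 12,
    ((isBigO_refl _ _).const_mul_left 9).add hconst.isBigO,
    fun V _ G => G.twinWidth_le_nine_mul_sqrt, fun _ => 12, hconst, fun V _ G => ?_⟩
  refine G.twinWidth_le_nine_mul_sqrt.trans (add_le_add_left ?_ _)
  apply Real.le_sqrt_of_sq_le
  rw [mul_pow, Real.sq_sqrt (Nat.cast_nonneg _)]
  have : (0 : ℝ) ≤ G.fedgeNum := Nat.cast_nonneg _
  linarith
end

section
/- Let G be a trigraph with maximum red degree 2 such that each red edge of G is incident to a vertex of (total) degree at most 2, and let G' be the graph obtained from G by recoloring all edges black. Then tww(G) ≤ tww(G') + 4. Moreover, if C' is any contraction sequence of G' and C is the contraction sequence of G performing the same contractions, then w(C) ≤ w(C') + 4. -/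
attribute [local instance] Classical.propDecidable

open Finset

universe u

namespace Trigraph

variable {V : Type u}

/-- The graph obtained from a trigraph by recoloring all edges black. -/
noncomputable def blacken (G : Trigraph V) : Trigraph V where
  verts := G.verts
  black := G.black ∪ G.red
  red := ∅
  black_nodiag := fun e he => by
    rcases Finset.mem_union.1 he with h | h
    exacts [G.black_nodiag e h, G.red_nodiag e h]
  red_nodiag := by simp
  black_support := fun e he x hx => by
    rcases Finset.mem_union.1 he with h | h
    exacts [G.black_support e h x hx, G.red_support e h x hx]
  red_support := by simp
  disj := Finset.disjoint_empty_right _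

end Trigraph

open Trigraph

namespace Trigraph

variable {V : Type u}

/-- `H` is the quotient trigraph of `G` by the retraction `f` of `G.verts` onto `H.verts`: two
vertices of `H` are joined by a black edge when their fibers are completely joined by black edges
in `G`, and are adjacent when some edge of `G` joins their fibers. -/
structure IsQuotient (G : Trigraph V) (f : V → V) (H : Trigraph V) : Prop where
  mapsTo : ∀ x ∈ G.verts, f x ∈ H.verts
  subset : H.verts ⊆ G.verts
  retract : ∀ a ∈ H.verts, f a = a
  black_iff : ∀ a ∈ H.verts, ∀ b ∈ H.verts, a ≠ b → (s(a, b) ∈ H.black ↔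
    ∀ x ∈ G.verts, ∀ y ∈ G.verts, f x = a → f y = b → s(x, y) ∈ G.black)
  adj_iff : ∀ a ∈ H.verts, ∀ b ∈ H.verts, a ≠ b → (s(a, b) ∈ H.black ∪ H.red ↔
    ∃ x ∈ G.verts, ∃ y ∈ G.verts, f x = a ∧ f y = b ∧ s(x, y) ∈ G.black ∪ G.red)

theorem IsQuotient.refl (G : Trigraph V) : G.IsQuotient id G where
  mapsTo x hx := hx
  subset := Finset.Subset.refl _
  retract _ _ := rfl
  black_iff a ha b hb _ := by
    constructor
    · rintro h x _ y _ rfl rfl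
      exact h
    · intro h
      exact h a ha b hb rfl rfl
  adj_iff a ha b hb _ := by
    constructor
    · intro h
      exact ⟨a, ha, b, hb, rfl, rfl, h⟩
    · rintro ⟨x, _, y, _, rfl, rfl, h⟩
      exact h

theorem IsQuotient.trans {G H K : Trigraph V} {f g : V → V} (hf : G.IsQuotient f H)
    (hg : H.IsQuotient g K) : G.IsQuotient (g ∘ f) K where
  mapsTo x hx := hg.mapsTo _ (hf.mapsTo x hx)
  subset := hg.subset.trans hf.subset
  retract a ha := by
    rw [Function.comp_apply, hf.retract a (hg.subset ha), hg.retract a ha]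
  black_iff a ha b hb hab := by
    rw [hg.black_iff a ha b hb hab]
    constructor
    · rintro h x hx y hy rfl rfl
      have hne : f x ≠ f y := fun e => hab (congrArg g e)
      exact (hf.black_iff _ (hf.mapsTo x hx) _ (hf.mapsTo y hy) hne).1
        (h _ (hf.mapsTo x hx) _ (hf.mapsTo y hy) rfl rfl) x hx y hy rfl rfl
    · rintro h x hx y hy rfl rfl
      refine (hf.black_iff x hx y hy fun e => hab (congrArg g e)).2 ?_
      rintro x' hx' y' hy' rfl rfl
      exact h x' hx' y' hy' rfl rfl
  adj_iff a ha b hb hab := by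
    rw [hg.adj_iff a ha b hb hab]
    constructor
    · rintro ⟨x, hx, y, hy, rfl, rfl, h⟩
      obtain ⟨x', hx', y', hy', rfl, rfl, h'⟩ :=
        (hf.adj_iff x hx y hy fun e => hab (congrArg g e)).1 h
      exact ⟨x', hx', y', hy', rfl, rfl, h'⟩
    · rintro ⟨x, hx, y, hy, rfl, rfl, h⟩
      have hne : f x ≠ f y := fun e => hab (congrArg g e)
      exact ⟨_, hf.mapsTo x hx, _, hf.mapsTo y hy, rfl, rfl,
        (hf.adj_iff _ (hf.mapsTo x hx) _ (hf.mapsTo y hy) hne).2 ⟨x, hx, y, hy, rfl, rfl, h⟩⟩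

theorem contract_verts_s4 (G : Trigraph V) (u v : V) :
    (G.contract u v).verts =
      if u ≠ v ∧ u ∈ G.verts ∧ v ∈ G.verts then G.verts.erase v else G.verts := by
  unfold contract
  split_ifs <;> rfl

theorem mem_cBlack_left_s4 {G : Trigraph V} {u v b : V} (hb : b ∈ G.verts.erase v) (hbu : b ≠ u) :
    s(u, b) ∈ G.cBlack u v ↔ s(u, b) ∈ G.black ∧ s(v, b) ∈ G.black := by
  have := Finset.mem_erase.1 hb
  simp [cBlack, this, hbu, hbu.symm]

theorem mem_cBlack_of_ne_s4 {G : Trigraph V} {u v a b : V} (ha : a ≠ u) (ha' : a ≠ v) (hb : b ≠ u)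
    (hb' : b ≠ v) : s(a, b) ∈ G.cBlack u v ↔ s(a, b) ∈ G.black := by
  simp [cBlack, ha.symm, ha'.symm, hb.symm, hb'.symm]

theorem mem_cBlack_union_cRed_left {G : Trigraph V} {u v b : V} (hb : b ∈ G.verts.erase v)
    (hbu : b ≠ u) : s(u, b) ∈ G.cBlack u v ∪ G.cRed u v ↔
      s(u, b) ∈ G.black ∪ G.red ∨ s(v, b) ∈ G.black ∪ G.red := by
  have := Finset.mem_erase.1 hb
  rw [Finset.mem_union, mem_cBlack_left_s4 hb hbu]
  simp [cRed, this, hbu, hbu.symm]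
  tauto

theorem mem_cBlack_union_cRed_of_ne {G : Trigraph V} {u v a b : V} (ha : a ≠ u) (ha' : a ≠ v)
    (hb : b ≠ u) (hb' : b ≠ v) :
    s(a, b) ∈ G.cBlack u v ∪ G.cRed u v ↔ s(a, b) ∈ G.black ∪ G.red := by
  rw [Finset.mem_union, mem_cBlack_of_ne_s4 ha ha' hb hb']
  simp [cRed, ha.symm, ha'.symm, hb.symm, hb'.symm]

theorem isQuotient_contract {G : Trigraph V} {u v : V}
    (h : u ≠ v ∧ u ∈ G.verts ∧ v ∈ G.verts) :
    G.IsQuotient (fun x => if x = v then u else x) (G.contract u v) := by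
  obtain ⟨huv, hu, hv⟩ := h
  have hverts : (G.contract u v).verts = G.verts.erase v := by
    rw [contract_verts_s4, if_pos ⟨huv, hu, hv⟩]
  have hblack : (G.contract u v).black = G.cBlack u v := by
    rw [contract, dif_pos ⟨huv, hu, hv⟩]
  have hredge : (G.contract u v).red = G.cRed u v := by
    rw [contract, dif_pos ⟨huv, hu, hv⟩]
  have fiber_u : ∀ x, (if x = v then u else x) = u ↔ x = u ∨ x = v := by grind
  have fiber_ne : ∀ a x, a ≠ u → a ≠ v → ((if x = v then u else x) = a ↔ x = a) := by grind
  refine ⟨?_, ?_, ?_, ?_, ?_⟩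
  · intro x hx
    rw [hverts]
    grind
  · rw [hverts]
    exact Finset.erase_subset _ _
  · intro a ha
    rw [hverts] at ha
    grind
  · rw [hverts, hblack]
    intro a ha b hb hab
    have ha' := Finset.mem_erase.1 ha
    have hb' := Finset.mem_erase.1 hb
    by_cases hau : a = u
    · subst hau
      rw [mem_cBlack_left_s4 hb hab.symm]
      simp only [fiber_u, fiber_ne b _ hab.symm hb'.1]
      grind
    · by_cases hbu : b = u
      · subst hbu
        rw [Sym2.eq_swap, mem_cBlack_left_s4 ha hab]
        simp only [fiber_u, fiber_ne a _ hau ha'.1]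
        grind [Sym2.eq_swap]
      · rw [mem_cBlack_of_ne_s4 hau ha'.1 hbu hb'.1]
        simp only [fiber_ne a _ hau ha'.1, fiber_ne b _ hbu hb'.1]
        grind
  · rw [hverts, hblack, hredge]
    intro a ha b hb hab
    have ha' := Finset.mem_erase.1 ha
    have hb' := Finset.mem_erase.1 hb
    generalize hE : G.black ∪ G.red = E
    by_cases hau : a = u
    · subst hau
      rw [mem_cBlack_union_cRed_left hb hab.symm, hE]
      simp only [fiber_u, fiber_ne b _ hab.symm hb'.1]
      grind
    · by_cases hbu : b = u
      · subst hbu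
        rw [Sym2.eq_swap, mem_cBlack_union_cRed_left ha hab, hE]
        simp only [fiber_u, fiber_ne a _ hau ha'.1]
        grind [Sym2.eq_swap]
      · rw [mem_cBlack_union_cRed_of_ne hau ha'.1 hbu hb'.1, hE]
        simp only [fiber_ne a _ hau ha'.1, fiber_ne b _ hbu hb'.1]
        grind

theorem contract_verts_congr {G H : Trigraph V} (h : G.verts = H.verts) (u v : V) :
    (G.contract u v).verts = (H.contract u v).verts := by
  rw [contract_verts_s4, contract_verts_s4, h]

theorem stage_verts_congr (ps : List (V × V)) {G H : Trigraph V} (h : G.verts = H.verts) :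
    (G.stage ps).verts = (H.stage ps).verts := by
  induction ps generalizing G H with
  | nil => exact h
  | cons p ps ih => exact ih (contract_verts_congr h p.1 p.2)

theorem validSteps_congr (ps : List (V × V)) {G H : Trigraph V} (h : G.verts = H.verts) :
    ValidSteps G ps ↔ ValidSteps H ps := by
  induction ps generalizing G H with
  | nil => simp only [ValidSteps]
  | cons p ps ih => simp only [ValidSteps, h, ih (contract_verts_congr h p.1 p.2)]

theorem isContractionSeq_congr (ps : List (V × V)) {G H : Trigraph V} (h : G.verts = H.verts) :
    G.IsContractionSeq ps ↔ H.IsContractionSeq ps := by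
  rw [IsContractionSeq, IsContractionSeq, validSteps_congr ps h, stage_verts_congr ps h]

/-- Performing the same contractions on trigraphs with the same vertices yields quotients by the
same retraction. -/
theorem exists_isQuotient_stage (ps : List (V × V)) {G H : Trigraph V} (h : G.verts = H.verts) :
    ∃ f, G.IsQuotient f (G.stage ps) ∧ H.IsQuotient f (H.stage ps) := by
  induction ps generalizing G H with
  | nil => exact ⟨id, .refl G, .refl H⟩
  | cons p ps ih =>
    obtain ⟨f, hG, hH⟩ := ih (contract_verts_congr h p.1 p.2)
    by_cases hp : p.1 ≠ p.2 ∧ p.1 ∈ G.verts ∧ p.2 ∈ G.verts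
    · exact ⟨_, (isQuotient_contract hp).trans hG, (isQuotient_contract (h ▸ hp)).trans hH⟩
    · rw [contract, dif_neg hp] at hG
      rw [contract, dif_neg (h ▸ hp)] at hH
      refine ⟨f, ?_, ?_⟩
      · rwa [stage, List.foldl_cons, contract, dif_neg hp]
      · rwa [stage, List.foldl_cons, contract, dif_neg (h ▸ hp)]

theorem card_filter_mk_mem_le (A : Finset V) (E : Finset (Sym2 V)) (x : V) :
    (A.filter fun y => s(x, y) ∈ E).card ≤ (E.filter fun e => x ∈ e).card := by
  refine Finset.card_le_card_of_injOn (fun y => s(x, y)) ?_ ?_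
  · intro y hy
    have hxy := (Finset.mem_filter.1 (Finset.mem_coe.1 hy)).2
    exact Finset.mem_coe.2 (Finset.mem_filter.2 ⟨hxy, Sym2.mem_mk_left x y⟩)
  · intro y _ z _ hyz
    exact Sym2.congr_right.1 hyz

/-- In a quotient, at most four vertices have a fiber that is completely joined to the fiber of `a`
and connected to it by some red edge. -/
theorem card_le_four_of_complete_of_red {G : Trigraph V} (hred : G.maxRedDeg ≤ 2)
    (hinc : ∀ e ∈ G.red, ∃ x ∈ e, G.deg x ≤ 2) (f : V → V) (a : V) (T : Finset V)
    (hT : T ⊆ G.verts) (hf : ∀ b ∈ T, f b = b)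
    (hcomplete : ∀ b ∈ T, ∀ x ∈ G.verts, ∀ y ∈ G.verts, f x = a → f y = b →
      s(x, y) ∈ G.black ∪ G.red)
    (hex : ∀ b ∈ T, ∃ x ∈ G.verts, ∃ y ∈ G.verts, f x = a ∧ f y = b ∧ s(x, y) ∈ G.red) :
    T.card ≤ 4 := by
  set X := G.verts.filter fun x => f x = a
  by_cases hcard : X.card ≤ 2
  · have hsub : T ⊆ X.biUnion fun x => (G.verts.filter fun y => s(x, y) ∈ G.red).image f := by
      intro b hb
      obtain ⟨x, hx, y, hy, hxa, hyb, hxy⟩ := hex b hb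
      exact Finset.mem_biUnion.2 ⟨x, Finset.mem_filter.2 ⟨hx, hxa⟩,
        Finset.mem_image.2 ⟨y, Finset.mem_filter.2 ⟨hy, hxy⟩, hyb⟩⟩
    have hle := (Finset.card_le_card hsub).trans (Finset.card_biUnion_le_card_mul X _ 2 ?_)
    · omega
    · intro x hx
      calc _ ≤ (G.verts.filter fun y => s(x, y) ∈ G.red).card := Finset.card_image_le
        _ ≤ G.redDeg x := card_filter_mk_mem_le _ _ x
        _ ≤ G.maxRedDeg := Finset.le_sup (Finset.mem_filter.1 hx).1
        _ ≤ 2 := hred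
  · obtain rfl | ⟨b, hb⟩ := T.eq_empty_or_nonempty
    · simp
    obtain ⟨x, hx, y, hy, hxa, hyb, hxy⟩ := hex b hb
    have hy2 : 2 < G.deg y := by
      refine (not_le.1 hcard).trans_le
        ((Finset.card_le_card ?_).trans (card_filter_mk_mem_le G.verts _ y))
      intro x' hx'
      obtain ⟨hx', hxa'⟩ := Finset.mem_filter.1 hx'
      exact Finset.mem_filter.2 ⟨hx', Sym2.eq_swap ▸ hcomplete b hb x' hx' y hy hxa' hyb⟩
    have hx2 : G.deg x ≤ 2 := by
      obtain ⟨z, hz, hz2⟩ := hinc _ hxy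
      rcases Sym2.mem_iff.1 hz with rfl | rfl
      · exact hz2
      · omega
    have hTx : T.card ≤ G.deg x := by
      refine (Finset.card_le_card ?_).trans (card_filter_mk_mem_le G.verts _ x)
      intro c hc
      exact Finset.mem_filter.2 ⟨hT hc, hcomplete c hc x hx c (hT hc) hxa (hf c hc)⟩
    omega

theorem redDeg_stage_le {G : Trigraph V} (hred : G.maxRedDeg ≤ 2)
    (hinc : ∀ e ∈ G.red, ∃ x ∈ e, G.deg x ≤ 2) (ps : List (V × V)) (a : V) :
    (G.stage ps).redDeg a ≤ (G.blacken.stage ps).redDeg a + 4 := by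
  obtain ⟨f, hH, hK⟩ := exists_isQuotient_stage ps (show G.verts = G.blacken.verts from rfl)
  have hverts := stage_verts_congr ps (show G.verts = G.blacken.verts from rfl)
  set H := G.stage ps
  set K := G.blacken.stage ps
  set T := H.verts.filter fun b => s(a, b) ∈ H.red ∧ s(a, b) ∉ K.red
  have hsub : (H.red.filter fun e => a ∈ e) ⊆
      (K.red.filter fun e => a ∈ e) ∪ T.image fun b => s(a, b) := by
    intro e he
    obtain ⟨he, hae⟩ := Finset.mem_filter.1 he
    obtain ⟨b, rfl⟩ := hae
    by_cases hK : s(a, b) ∈ K.red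
    · exact Finset.mem_union_left _ (Finset.mem_filter.2 ⟨hK, Sym2.mem_mk_left a b⟩)
    · exact Finset.mem_union_right _ (Finset.mem_image_of_mem _ (Finset.mem_filter.2
        ⟨H.red_support _ he b (Sym2.mem_mk_right a b), he, hK⟩))
  have hT : ∀ b ∈ T,
      (∀ x ∈ G.verts, ∀ y ∈ G.verts, f x = a → f y = b → s(x, y) ∈ G.black ∪ G.red) ∧
      ∃ x ∈ G.verts, ∃ y ∈ G.verts, f x = a ∧ f y = b ∧ s(x, y) ∈ G.red := by
    intro b hb
    obtain ⟨hb, hbH, hbK⟩ := Finset.mem_filter.1 hb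
    have ha := H.red_support _ hbH a (Sym2.mem_mk_left a b)
    have hab : a ≠ b := fun h => H.red_nodiag _ hbH (Sym2.mk_isDiag_iff.2 h)
    have hadj := (hH.adj_iff a ha b hb hab).1 (Finset.mem_union_right _ hbH)
    have hcomplete : ∀ x ∈ G.verts, ∀ y ∈ G.verts, f x = a → f y = b →
        s(x, y) ∈ G.black ∪ G.red := by
      refine (hK.black_iff a (hverts ▸ ha) b (hverts ▸ hb) hab).1 ?_
      have hadjK := (hK.adj_iff a (hverts ▸ ha) b (hverts ▸ hb) hab).2 (by
        obtain ⟨x, hx, y, hy, hxa, hyb, hxy⟩ := hadj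
        exact ⟨x, hx, y, hy, hxa, hyb, Finset.mem_union_left _ hxy⟩)
      exact (Finset.mem_union.1 hadjK).resolve_right hbK
    refine ⟨hcomplete, ?_⟩
    have hnb : s(a, b) ∉ H.black := fun h => Finset.disjoint_left.1 H.disj h hbH
    rw [hH.black_iff a ha b hb hab] at hnb
    push Not at hnb
    obtain ⟨x, hx, y, hy, hxa, hyb, hxy⟩ := hnb
    exact ⟨x, hx, y, hy, hxa, hyb,
      (Finset.mem_union.1 (hcomplete x hx y hy hxa hyb)).resolve_left hxy⟩
  have hTH : T ⊆ H.verts := Finset.filter_subset _ _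
  have hT4 : T.card ≤ 4 := card_le_four_of_complete_of_red hred hinc f a T
    (hTH.trans hH.subset) (fun b hb => hH.retract b (hTH hb))
    (fun b hb => (hT b hb).1) (fun b hb => (hT b hb).2)
  calc H.redDeg a ≤ _ := Finset.card_le_card hsub
    _ ≤ K.redDeg a + (T.image fun b => s(a, b)).card := Finset.card_union_le _ _
    _ ≤ K.redDeg a + 4 := Nat.add_le_add_left (Finset.card_image_le.trans hT4) _

theorem maxRedDeg_stage_le {G : Trigraph V} (hred : G.maxRedDeg ≤ 2)
    (hinc : ∀ e ∈ G.red, ∃ x ∈ e, G.deg x ≤ 2) (ps : List (V × V)) :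
    (G.stage ps).maxRedDeg ≤ (G.blacken.stage ps).maxRedDeg + 4 := by
  refine Finset.sup_le fun a ha => (redDeg_stage_le hred hinc ps a).trans ?_
  rw [stage_verts_congr ps (show G.verts = G.blacken.verts from rfl)] at ha
  exact Nat.add_le_add_right (Finset.le_sup (f := (G.blacken.stage ps).redDeg) ha) 4

theorem foldr_max_map_le_add {ι : Type*} (l : List ι) {m n : ι → ℕ} {c : ℕ}
    (h : ∀ i, m i ≤ n i + c) : (l.map m).foldr max 0 ≤ (l.map n).foldr max 0 + c := by
  induction l with
  | nil => simp
  | cons i l ih =>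
    simp only [List.map_cons, List.foldr_cons]
    have := h i
    omega

theorem seqWidth_le {G : Trigraph V} (hred : G.maxRedDeg ≤ 2)
    (hinc : ∀ e ∈ G.red, ∃ x ∈ e, G.deg x ≤ 2) (ps : List (V × V)) :
    G.seqWidth ps ≤ G.blacken.seqWidth ps + 4 :=
  foldr_max_map_le_add _ fun j => maxRedDeg_stage_le hred hinc (ps.take j)

end Trigraph

/-- **Recoloring red edges black costs at most 4.** If `G` is a trigraph with maximum red
degree at most 2 in which every red edge is incident to a vertex of (total) degree at most 2,
and `G'` is obtained from `G` by making all edges black, then `tww(G) ≤ tww(G') + 4`;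
moreover, any contraction sequence `C'` of `G'` yields, by performing the same contractions
on `G`, a contraction sequence `C` of `G` with `w(C) ≤ w(C') + 4`. -/
theorem tww_blacken {V : Type u} (G : Trigraph V)
    (hred : G.maxRedDeg ≤ 2)
    (hinc : ∀ e ∈ G.red, ∃ x ∈ e, G.deg x ≤ 2) :
    G.tww ≤ G.blacken.tww + 4 ∧
    ∀ ps : List (V × V), G.blacken.IsContractionSeq ps →
      G.IsContractionSeq ps ∧ G.seqWidth ps ≤ G.blacken.seqWidth ps + 4 := by
  have hiff (ps : List (V × V)) : G.IsContractionSeq ps ↔ G.blacken.IsContractionSeq ps :=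
    isContractionSeq_congr ps rfl
  refine ⟨?_, fun ps hps => ⟨(hiff ps).2 hps, seqWidth_le hred hinc ps⟩⟩
  by_cases hex : ∃ ps, G.blacken.IsContractionSeq ps
  · obtain ⟨ps₀, hps₀⟩ := hex
    obtain ⟨ps, hps, hw⟩ : G.blacken.tww ∈
        {t | ∃ ps, G.blacken.IsContractionSeq ps ∧ G.blacken.seqWidth ps ≤ t} :=
      Nat.sInf_mem ⟨_, ps₀, hps₀, le_rfl⟩
    exact Nat.sInf_le ⟨ps, (hiff ps).2 hps,
      (seqWidth_le hred hinc ps).trans (Nat.add_le_add_right hw 4)⟩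
  · have hempty : {t | ∃ ps, G.IsContractionSeq ps ∧ G.seqWidth ps ≤ t} = ∅ :=
      Set.eq_empty_of_forall_notMem fun t ⟨ps, hps, _⟩ => hex ⟨ps, (hiff ps).1 hps⟩
    rw [tww, hempty, Nat.sInf_empty]
    exact Nat.zero_le _
end
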